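/- Let A be an abelian von Neumann algebra with a trace-preserving action Γ↷^σ A such that the inclusion L(Γ) ⊆ A⋊Γ admits a finite Pimsner–Popa basis. Then A is completely atomic. Moreover, if Γ↷A is ergodic, then Γ↷A is transitive. -/

import Mathlib

/-!
Common framework: we model tracial von Neumann algebras concretely, as von Neumann
algebras `M ⊆ B(H)` (Mathlib's `VonNeumannAlgebra H`, i.e. star-subalgebras equal to
their double commutant) equipped with a faithful tracial state, and we model the
crossed product `A ⋊ Γ` of a trace-preserving action axiomatically: `M` contains a
copy of `A` and a group `(u γ)` of unitaries normalizing `A`, such that the canonical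
trace-preserving conditional expectation `E_A` kills `u γ` for `γ ≠ 1`, and such that
an element of `M` all of whose Fourier coefficients `E_A (x (u γ)*)` vanish is `0`.
Probability-measure-preserving actions `Γ ↷ (X, μ)` are modelled via the associated
trace-preserving action on the abelian von Neumann algebra `A = L^∞(X)`.
-/

noncomputable section

open scoped Classical

namespace CD

/-- A group has infinite conjugacy classes (icc) if every nontrivial conjugacy
class is infinite. -/
def IsICC (Γ : Type) [Group Γ] : Prop :=
  ∀ γ : Γ, γ ≠ 1 → {g : Γ | ∃ h : Γ, g = h * γ * h⁻¹}.Infinite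

/-- A faithful tracial state on (the elements of) a set `M ⊆ B(H)` (in applications,
a von Neumann algebra), given as a globally defined linear functional whose
axioms are imposed on `M`. -/
structure TraceOn (H : Type) [NormedAddCommGroup H] [InnerProductSpace ℂ H] [CompleteSpace H]
    (M : Set (H →L[ℂ] H)) : Type where
  τ : (H →L[ℂ] H) →ₗ[ℂ] ℂ
  unital : τ 1 = 1
  tracial : ∀ x ∈ M, ∀ y ∈ M, τ (x * y) = τ (y * x)
  star_eq : ∀ x ∈ M, τ (star x) = starRingEnd ℂ (τ x)
  nonneg : ∀ x ∈ M, 0 ≤ (τ (star x * x)).re ∧ (τ (star x * x)).im = 0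
  faithful : ∀ x ∈ M, τ (star x * x) = 0 → x = 0

variable {H : Type} [NormedAddCommGroup H] [InnerProductSpace ℂ H] [CompleteSpace H]

/-- The 2-norm `‖x‖₂ = τ(x* x)^{1/2}` associated with a trace. -/
def TraceOn.norm2 {M : Set (H →L[ℂ] H)} (tr : TraceOn H M) (x : H →L[ℂ] H) : ℝ :=
  Real.sqrt (tr.τ (star x * x)).re

/-- The (unique) trace-preserving conditional expectation from `M` onto a
von Neumann subalgebra `N ⊆ M`. -/
structure CondExpOn (H : Type) [NormedAddCommGroup H] [InnerProductSpace ℂ H] [CompleteSpace H]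
    (M N : Set (H →L[ℂ] H)) (tr : TraceOn H M) : Type where
  E : (H →L[ℂ] H) →ₗ[ℂ] (H →L[ℂ] H)
  mem : ∀ x ∈ M, E x ∈ N
  fix : ∀ x ∈ N, E x = x
  bimod : ∀ a ∈ N, ∀ b ∈ N, ∀ x ∈ M, E (a * x * b) = a * E x * b
  star_map : ∀ x ∈ M, E (star x) = star (E x)
  trace_eq : ∀ x ∈ M, tr.τ (E x) = tr.τ x
  contractive : ∀ x ∈ M, tr.norm2 (E x) ≤ tr.norm2 x

/-- The double commutant of a subset of `B(H)`: the von Neumann algebra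
generated by `S` (for `S` a star-closed unital set). -/
def vnGen (S : Set (H →L[ℂ] H)) : Set (H →L[ℂ] H) :=
  Set.centralizer (Set.centralizer S)

/-- Model of the crossed product von Neumann algebra `M = A ⋊ Γ` of a
trace-preserving action `Γ ↷ (A, τ)`: `M` is generated by a copy of `A`
and canonical unitaries `(u γ)` implementing the action, with its canonical
conditional expectation `E_A` onto `A` (characterising the Fourier coefficients),
together with the group von Neumann algebra `L(Γ) = {u γ : γ}'' ⊆ M` and the
conditional expectation onto it. -/
structure CrossedProduct (Γ : Type) [Group Γ]
    (H : Type) [NormedAddCommGroup H] [InnerProductSpace ℂ H] [CompleteSpace H] : Type where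
  M : VonNeumannAlgebra H
  A : VonNeumannAlgebra H
  A_sub : (A : Set (H →L[ℂ] H)) ⊆ (M : Set (H →L[ℂ] H))
  tr : TraceOn H (M : Set (H →L[ℂ] H))
  u : Γ → (H →L[ℂ] H)
  u_mem : ∀ γ, u γ ∈ M
  u_one : u 1 = 1
  u_mul : ∀ γ δ, u γ * u δ = u (γ * δ)
  u_star : ∀ γ, star (u γ) = u γ⁻¹
  conj_mem : ∀ (γ : Γ), ∀ a ∈ A, u γ * a * star (u γ) ∈ A
  EA : CondExpOn H (M : Set (H →L[ℂ] H)) (A : Set (H →L[ℂ] H)) tr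
  EA_u : ∀ γ : Γ, γ ≠ 1 → EA.E (u γ) = 0
  fourier_sep : ∀ x ∈ M, (∀ γ : Γ, EA.E (x * star (u γ)) = 0) → x = 0
  Lg : VonNeumannAlgebra H
  Lg_eq : (Lg : Set (H →L[ℂ] H)) = vnGen (Set.range u)
  Lg_sub : (Lg : Set (H →L[ℂ] H)) ⊆ (M : Set (H →L[ℂ] H))
  EL : CondExpOn H (M : Set (H →L[ℂ] H)) (Lg : Set (H →L[ℂ] H)) tr

variable {Γ : Type} [Group Γ]

/-- The action `σ_γ = Ad(u γ)` of `Γ` on `B(H)`, restricting to the given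
action on `A`. -/
def CrossedProduct.σ (X : CrossedProduct Γ H) (γ : Γ) (x : H →L[ℂ] H) : H →L[ℂ] H :=
  X.u γ * x * star (X.u γ)

/-- The action is properly outer over the center of `P`; for abelian `P` this is
the usual freeness of the action. -/
def ProperlyOuterOn (X : CrossedProduct Γ H) (P : Set (H →L[ℂ] H)) : Prop :=
  ∀ γ : Γ, γ ≠ 1 → ∀ a ∈ P, (∀ b ∈ P, X.σ γ b * a = a * b) → a = 0

/-- Freeness of the action `Γ ↷ A`. -/
def IsFree (X : CrossedProduct Γ H) : Prop := ProperlyOuterOn X (X.A : Set (H →L[ℂ] H))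

/-- Ergodicity of the action `Γ ↷ A`: the fixed points are the scalars. -/
def IsErgodic (X : CrossedProduct Γ H) : Prop :=
  ∀ a ∈ X.A, (∀ γ : Γ, X.σ γ a = a) → ∃ c : ℂ, a = c • (1 : H →L[ℂ] H)

def IsAbelianSet (S : Set (H →L[ℂ] H)) : Prop := ∀ x ∈ S, ∀ y ∈ S, x * y = y * x

/-- `Q` is a `Γ`-invariant subset (in applications, subalgebra). -/
def InvariantUnder (X : CrossedProduct Γ H) (Q : Set (H →L[ℂ] H)) : Prop :=
  ∀ (γ : Γ), ∀ q ∈ Q, X.σ γ q ∈ Q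

/-- The intermediate crossed product `Q ⋊ Γ ⊆ A ⋊ Γ` of a (`Γ`-invariant)
subalgebra `Q ⊆ A`: those elements all of whose Fourier coefficients lie in `Q`. -/
def midCP (X : CrossedProduct Γ H) (Q : Set (H →L[ℂ] H)) : Set (H →L[ℂ] H) :=
  {x | x ∈ X.M ∧ ∀ γ : Γ, X.EA.E (x * star (X.u γ)) ∈ Q}

/-- The intermediate crossed product `A ⋊ K ⊆ A ⋊ Γ` of a subgroup `K ≤ Γ`:
those elements whose Fourier coefficients are supported on `K`. -/
def subgpCP (X : CrossedProduct Γ H) (K : Subgroup Γ) : Set (H →L[ℂ] H) :=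
  {x | x ∈ X.M ∧ ∀ γ : Γ, γ ∉ K → X.EA.E (x * star (X.u γ)) = 0}

/-- The quasinormalizer `QN_M(P)` of `P` inside `M`. -/
def QNset (M P : Set (H →L[ℂ] H)) : Set (H →L[ℂ] H) :=
  {x | x ∈ M ∧ ∃ (n : ℕ) (y : Fin n → (H →L[ℂ] H)), (∀ i, y i ∈ M) ∧
    (∀ p ∈ P, ∃ q : Fin n → (H →L[ℂ] H), (∀ i, q i ∈ P) ∧ p * x = ∑ i, y i * q i) ∧
    (∀ p ∈ P, ∃ q : Fin n → (H →L[ℂ] H), (∀ i, q i ∈ P) ∧ x * p = ∑ i, q i * y i)}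

def IsUnitaryIn (S : Set (H →L[ℂ] H)) (x : H →L[ℂ] H) : Prop :=
  x ∈ S ∧ star x * x = 1 ∧ x * star x = 1

def IsProjIn (S : Set (H →L[ℂ] H)) (p : H →L[ℂ] H) : Prop :=
  p ∈ S ∧ star p = p ∧ p * p = p

/-- The relative commutant `N' ∩ S`. -/
def commutantIn (N S : Set (H →L[ℂ] H)) : Set (H →L[ℂ] H) :=
  {x | x ∈ S ∧ ∀ y ∈ N, x * y = y * x}

/-- Conjugation `w ( · ) w*` applied to a set. -/
def conjSet (w : H →L[ℂ] H) (S : Set (H →L[ℂ] H)) : Set (H →L[ℂ] H) :=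
  (fun y => w * y * star w) '' S

/-- The scalars `ℂ 1 ⊆ B(H)`. -/
def scalars (H : Type) [NormedAddCommGroup H] [InnerProductSpace ℂ H] [CompleteSpace H] :
    Set (H →L[ℂ] H) :=
  Set.range (fun c : ℂ => c • (1 : H →L[ℂ] H))

/-- The extension `P₀ ⊆ P` of `Γ`-algebras is compact: there is a family `F ⊆ P`
with dense `‖·‖₂`-span in `P` such that the `Γ`-orbit of each `f ∈ F` can be
uniformly approximated by finitely many "`P₀`-finite rank modules". -/
def IsCompactExt (X : CrossedProduct Γ H) (P₀ P : Set (H →L[ℂ] H)) : Prop :=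
  ∃ F : Set (H →L[ℂ] H), F ⊆ P ∧
    (∀ p ∈ P, ∀ ε : ℝ, 0 < ε → ∃ (n : ℕ) (c : Fin n → ℂ) (f : Fin n → (H →L[ℂ] H)),
      (∀ i, f i ∈ F) ∧ X.tr.norm2 (p - ∑ i, c i • f i) ≤ ε) ∧
    (∀ f ∈ F, ∀ ε : ℝ, 0 < ε → ∃ (n : ℕ) (ξ : Fin n → (H →L[ℂ] H)) (C : ℝ),
      (∀ i, ξ i ∈ P) ∧
      ∀ γ : Γ, ∃ κ : Fin n → (H →L[ℂ] H), (∀ i, κ i ∈ P₀) ∧ (∀ i, ‖κ i‖ ≤ C) ∧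
        X.tr.norm2 (X.σ γ f - ∑ i, κ i * ξ i) ≤ ε)

/-- The action `Γ ↷ A` is compact: the extension over the scalars is compact. -/
def IsCompactAction (X : CrossedProduct Γ H) : Prop :=
  IsCompactExt X (scalars H) (X.A : Set (H →L[ℂ] H))

/-- The `Γ`-invariant subalgebra `B ⊆ A` gives a mixing extension: for
`t, z ∈ A ⊖ B` one has `‖E_B(t σ_γ(z))‖₂ → 0` as `γ → ∞`. -/
def IsMixingExt (X : CrossedProduct Γ H) (B : Set (H →L[ℂ] H))
    (EB : CondExpOn H (X.M : Set (H →L[ℂ] H)) B X.tr) : Prop :=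
  ∀ t ∈ X.A, ∀ z ∈ X.A, EB.E t = 0 → EB.E z = 0 →
    Filter.Tendsto (fun γ : Γ => X.tr.norm2 (EB.E (t * X.σ γ z))) Filter.cofinite (nhds 0)

/-- A `*`-isomorphism from (the von Neumann algebra with underlying set) `M ⊆ B(H₁)`
onto `N ⊆ B(H₂)`, given as a globally defined map with all axioms imposed on `M`. -/
structure StarIsoOn {H₁ : Type} [NormedAddCommGroup H₁] [InnerProductSpace ℂ H₁]
    [CompleteSpace H₁] {H₂ : Type} [NormedAddCommGroup H₂] [InnerProductSpace ℂ H₂]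
    [CompleteSpace H₂] (M : Set (H₁ →L[ℂ] H₁)) (N : Set (H₂ →L[ℂ] H₂)) : Type where
  Θ : (H₁ →L[ℂ] H₁) → (H₂ →L[ℂ] H₂)
  mem : ∀ x ∈ M, Θ x ∈ N
  map_one : Θ 1 = 1
  map_add : ∀ x ∈ M, ∀ y ∈ M, Θ (x + y) = Θ x + Θ y
  map_smul : ∀ (c : ℂ), ∀ x ∈ M, Θ (c • x) = c • Θ x
  map_mul : ∀ x ∈ M, ∀ y ∈ M, Θ (x * y) = Θ x * Θ y
  map_star : ∀ x ∈ M, Θ (star x) = star (Θ x)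
  inj : ∀ x ∈ M, ∀ y ∈ M, Θ x = Θ y → x = y
  surj : ∀ y ∈ N, ∃ x ∈ M, Θ x = y

/-- `r` is the (Pimsner–Popa/Jones) index of the inclusion `N ⊆ M`, witnessed by a
finite Pimsner–Popa basis `m₁, …, m_k` with `E_N (m_i m_j*) = δ_{ij} p_i`,
`x = ∑ᵢ E_N(x mᵢ*) mᵢ` for `x ∈ M`, and `r = ∑ᵢ τ(pᵢ)`. -/
def HasPPIndex {Mamb : Set (H →L[ℂ] H)} (tr : TraceOn H Mamb)
    (M N : Set (H →L[ℂ] H)) (r : ℝ) : Prop :=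
  ∃ E : (H →L[ℂ] H) →ₗ[ℂ] (H →L[ℂ] H),
    (∀ x ∈ M, E x ∈ N) ∧ (∀ x ∈ N, E x = x) ∧
    (∀ a ∈ N, ∀ b ∈ N, ∀ x ∈ M, E (a * x * b) = a * E x * b) ∧
    (∀ x ∈ M, tr.τ (E x) = tr.τ x) ∧
    ∃ (k : ℕ) (m p : Fin k → (H →L[ℂ] H)),
      (∀ i, m i ∈ M) ∧ (∀ i, p i ∈ N ∧ star (p i) = p i ∧ p i * p i = p i) ∧
      (∀ i j, E (m i * star (m j)) = if i = j then p i else 0) ∧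
      (∀ x ∈ M, x = ∑ i, E (x * star (m i)) * m i) ∧
      r = (∑ i, tr.τ (p i)).re

/-- The inclusion `N ⊆ M` has finite (Pimsner–Popa/Jones) index. -/
def FiniteIndexIn {Mamb : Set (H →L[ℂ] H)} (tr : TraceOn H Mamb)
    (M N : Set (H →L[ℂ] H)) : Prop :=
  ∃ r : ℝ, HasPPIndex tr M N r

/-- `S` (a von Neumann algebra) is a factor: trivial center. -/
def IsFactorSet (S : Set (H →L[ℂ] H)) : Prop :=
  ∀ x ∈ S, (∀ y ∈ S, x * y = y * x) → ∃ c : ℂ, x = c • (1 : H →L[ℂ] H)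

/-- `S` is a II₁ factor (with respect to the trace `tr`): a factor whose
projections realize every trace value in `[0,1]`. -/
def IsII1On {Mamb : Set (H →L[ℂ] H)} (tr : TraceOn H Mamb) (S : Set (H →L[ℂ] H)) : Prop :=
  IsFactorSet S ∧ ∀ r : ℝ, 0 ≤ r → r ≤ 1 →
    ∃ p ∈ S, star p = p ∧ p * p = p ∧ tr.τ p = (r : ℂ)

def IsFinDimSet (S : Set (H →L[ℂ] H)) : Prop :=
  ∃ (n : ℕ) (v : Fin n → (H →L[ℂ] H)), (∀ i, v i ∈ S) ∧
    ∀ x ∈ S, ∃ c : Fin n → ℂ, x = ∑ i, c i • v i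

def IsStarSubalgSet (S : Set (H →L[ℂ] H)) : Prop :=
  (1 : H →L[ℂ] H) ∈ S ∧ (∀ x ∈ S, ∀ y ∈ S, x + y ∈ S) ∧ (∀ x ∈ S, ∀ y ∈ S, x * y ∈ S) ∧
    (∀ (c : ℂ), ∀ x ∈ S, c • x ∈ S) ∧ (∀ x ∈ S, star x ∈ S)

/-- `S` is approximately finite dimensional (with respect to `‖·‖₂`); by Connes'
theorem this is equivalent to amenability for (separable, tracial) von Neumann
algebras. -/
def IsAFD {Mamb : Set (H →L[ℂ] H)} (tr : TraceOn H Mamb) (S : Set (H →L[ℂ] H)) : Prop :=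
  ∃ Q : ℕ → Set (H →L[ℂ] H), (∀ n, Q n ⊆ S) ∧ (∀ n, Q n ⊆ Q (n + 1)) ∧
    (∀ n, IsFinDimSet (Q n)) ∧ (∀ n, IsStarSubalgSet (Q n)) ∧
    ∀ x ∈ S, ∀ ε : ℝ, 0 < ε → ∃ n, ∃ y ∈ Q n, tr.norm2 (x - y) ≤ ε

/-- `S` is diffuse: it has no minimal projections. -/
def IsDiffuseSet (S : Set (H →L[ℂ] H)) : Prop :=
  ∀ p, IsProjIn S p → p ≠ 0 →
    ∃ q, IsProjIn S q ∧ q ≠ 0 ∧ q ≠ p ∧ q * p = q ∧ p * q = q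

/-- The (trace-preserving) action of `Γ` on the subalgebra `Q` is transitive:
`Q` is spanned by finitely many orthogonal minimal projections summing to `1`
which are permuted transitively by `Γ`. -/
def IsTransitiveOn (X : CrossedProduct Γ H) (Q : Set (H →L[ℂ] H)) : Prop :=
  ∃ (n : ℕ) (e : Fin n → (H →L[ℂ] H)),
    (∀ i, e i ∈ Q ∧ star (e i) = e i ∧ e i * e i = e i) ∧
    (∀ i j, i ≠ j → e i * e j = 0) ∧ (∑ i, e i = 1) ∧
    (∀ q ∈ Q, ∃ c : Fin n → ℂ, q = ∑ i, c i • e i) ∧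
    (∀ i j, ∃ γ : Γ, X.σ γ (e i) = e j)

/-- An abelian von Neumann algebra `S` is completely atomic: every nonzero
projection dominates a minimal projection. -/
def IsCompletelyAtomic (S : Set (H →L[ℂ] H)) : Prop :=
  ∀ p, IsProjIn S p → p ≠ 0 →
    ∃ q, IsProjIn S q ∧ q ≠ 0 ∧ q * p = q ∧
      ∀ r, IsProjIn S r → r * q = r → r = 0 ∨ r = q

end CD

namespace CDX
set_option linter.unusedSectionVars false
open CD
open scoped InnerProductSpace

variable {H : Type} [NormedAddCommGroup H] [InnerProductSpace ℂ H] [CompleteSpace H]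

theorem mem_of_comm (M : VonNeumannAlgebra H) {x : H →L[ℂ] H}
    (h : ∀ c ∈ M.commutant, c * x = x * c) : x ∈ M := by
  rw [← M.commutant_commutant, VonNeumannAlgebra.mem_commutant_iff]
  exact h

theorem csmul_mem (M : VonNeumannAlgebra H) (c : ℂ) {x : H →L[ℂ] H} (h : x ∈ M) : c • x ∈ M :=
  M.toStarSubalgebra.smul_mem h c

theorem cfc_mem (M : VonNeumannAlgebra H) {y : H →L[ℂ] H} (hy : y ∈ M) (hs : IsSelfAdjoint y)
    (f : ℝ → ℝ) : cfc f y ∈ M := by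
  apply mem_of_comm
  intro c hc
  have h : Commute y c := (VonNeumannAlgebra.mem_commutant_iff.1 hc) y hy
  exact (hs.commute_cfc h f).symm.eq

theorem pos_inner {y : H →L[ℂ] H} (h : 0 ≤ y) (v : H) : 0 ≤ (⟪y v, v⟫_ℂ).re := by
  rw [ContinuousLinearMap.nonneg_iff_isPositive] at h
  exact h.re_inner_nonneg_left v

theorem nonneg_of_inner {y : H →L[ℂ] H} (hs : star y = y) (h : ∀ v, 0 ≤ (⟪y v, v⟫_ℂ).re) :
    0 ≤ y := by
  rw [ContinuousLinearMap.nonneg_iff_isPositive, ContinuousLinearMap.isPositive_def']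
  exact ⟨hs, fun v => h v⟩

theorem pos_star {y : H →L[ℂ] H} (h : 0 ≤ y) : star y = y := (IsSelfAdjoint.of_nonneg h).star_eq

theorem exists_sqrt (M : VonNeumannAlgebra H) {y : H →L[ℂ] H} (hy : y ∈ M) (h : 0 ≤ y) :
    ∃ s ∈ M, 0 ≤ s ∧ star s = s ∧ s * s = y := by
  have hs : IsSelfAdjoint y := IsSelfAdjoint.of_nonneg h
  have h0 : 0 ≤ cfc Real.sqrt y := cfc_nonneg (fun t _ => Real.sqrt_nonneg t)
  refine ⟨cfc Real.sqrt y, cfc_mem M hy hs _, h0, pos_star h0, ?_⟩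
  rw [← cfc_mul Real.sqrt Real.sqrt y]
  conv_rhs => rw [← cfc_id' ℝ y]
  apply cfc_congr
  intro t ht
  exact Real.mul_self_sqrt (spectrum_nonneg_of_nonneg h ht)

theorem exists_pos_neg (M : VonNeumannAlgebra H) {y : H →L[ℂ] H} (hy : y ∈ M) (h : star y = y) :
    ∃ a ∈ M, ∃ b ∈ M, 0 ≤ a ∧ 0 ≤ b ∧ y = a - b ∧ a * b = 0 ∧ b * a = 0 := by
  have hs : IsSelfAdjoint y := h
  refine ⟨cfc (fun t : ℝ => max t 0) y, cfc_mem M hy hs _, cfc (fun t : ℝ => max (-t) 0) y,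
    cfc_mem M hy hs _, cfc_nonneg (fun t _ => le_max_right _ _),
    cfc_nonneg (fun t _ => le_max_right _ _), ?_, ?_, ?_⟩
  · rw [← cfc_sub (fun t : ℝ => max t 0) (fun t : ℝ => max (-t) 0) y]
    conv_lhs => rw [← cfc_id' ℝ y]
    apply cfc_congr
    intro t ht
    simp only
    rcases le_total t 0 with h | h
    · rw [max_eq_right h, max_eq_left (by linarith)]; ring
    · rw [max_eq_left h, max_eq_right (by linarith)]; ring
  · rw [← cfc_mul (fun t : ℝ => max t 0) (fun t : ℝ => max (-t) 0) y]
    rw [← cfc_const_zero ℝ y]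
    apply cfc_congr
    intro t ht
    simp only
    rcases le_total t 0 with h | h
    · rw [max_eq_right h]; ring
    · rw [max_eq_right (a := -t) (by linarith)]; ring
  · rw [← cfc_mul (fun t : ℝ => max (-t) 0) (fun t : ℝ => max t 0) y]
    rw [← cfc_const_zero ℝ y]
    apply cfc_congr
    intro t ht
    simp only
    rcases le_total t 0 with h | h
    · rw [max_eq_right h]; ring
    · rw [max_eq_right (a := -t) (by linarith)]; ring

theorem inner_star (x : H →L[ℂ] H) (v w : H) : ⟪(star x) v, w⟫_ℂ = ⟪v, x w⟫_ℂ := by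
  rw [ContinuousLinearMap.star_eq_adjoint, ContinuousLinearMap.adjoint_inner_left]

theorem inner_star' (x : H →L[ℂ] H) (v w : H) : ⟪v, (star x) w⟫_ℂ = ⟪x v, w⟫_ℂ := by
  rw [ContinuousLinearMap.star_eq_adjoint, ContinuousLinearMap.adjoint_inner_right]

theorem inner_star_mul (x : H →L[ℂ] H) (v : H) : (⟪(star x * x) v, v⟫_ℂ).re = ‖x v‖ ^ 2 := by
  rw [mul_apply_eq_comp, inner_star, ← inner_self_eq_norm_sq (𝕜 := ℂ)]; rfl

theorem proj_mem (M : VonNeumannAlgebra H) (K : Submodule ℂ H) [K.HasOrthogonalProjection]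
    (h : ∀ c ∈ M.commutant, ∀ v ∈ K, c v ∈ K) : K.starProjection ∈ M := by
  rw [VonNeumannAlgebra.IsStarProjection.mem_iff isStarProjection_starProjection]
  intro c hc
  rw [Submodule.range_starProjection, Module.End.mem_invtSubmodule]
  intro v hv
  exact h c hc v hv

/-- `τ(x* x)` -/
def t2 {M : Set (H →L[ℂ] H)} (tr : TraceOn H M) (x : H →L[ℂ] H) : ℝ := (tr.τ (star x * x)).re

variable {M : VonNeumannAlgebra H} (tr : TraceOn H (M : Set (H →L[ℂ] H)))

theorem t2_nonneg {x : H →L[ℂ] H} (hx : x ∈ M) : 0 ≤ t2 tr x := (tr.nonneg x hx).1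

theorem t2_eq {x : H →L[ℂ] H} (hx : x ∈ M) : tr.τ (star x * x) = (t2 tr x : ℂ) := by
  apply Complex.ext <;> simp [t2, (tr.nonneg x hx).2]

theorem t2_zero {x : H →L[ℂ] H} (hx : x ∈ M) (h : t2 tr x = 0) : x = 0 := by
  apply tr.faithful x hx
  rw [t2_eq tr hx, h]; simp

theorem t2_star {x : H →L[ℂ] H} (hx : x ∈ M) : t2 tr (star x) = t2 tr x := by
  unfold t2
  rw [star_star, tr.tracial x hx (star x) (star_mem hx)]

theorem tr_pos {y : H →L[ℂ] H} (hy : y ∈ M) (h : 0 ≤ y) : 0 ≤ (tr.τ y).re := by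
  obtain ⟨s, hs, _, hss, e⟩ := exists_sqrt M hy h
  have := t2_nonneg tr hs
  rwa [t2, hss, e] at this

theorem tr_pos_zero {y : H →L[ℂ] H} (hy : y ∈ M) (h : 0 ≤ y) (h0 : (tr.τ y).re ≤ 0) : y = 0 := by
  obtain ⟨s, hs, _, hss, e⟩ := exists_sqrt M hy h
  have h1 := t2_nonneg tr hs
  have : t2 tr s = 0 := by
    refine le_antisymm ?_ h1
    rw [t2, hss, e]; exact h0
  rw [← e, t2_zero tr hs this]; simp

theorem tr_mono {x y : H →L[ℂ] H} (hx : x ∈ M) (hy : y ∈ M) (h : x ≤ y) :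
    (tr.τ x).re ≤ (tr.τ y).re := by
  have := tr_pos tr (sub_mem hy hx) (sub_nonneg.2 h)
  rw [map_sub, Complex.sub_re] at this
  linarith

theorem t2_mul_le {b x : H →L[ℂ] H} (hb : b ∈ M) (hx : x ∈ M) {C : ℝ} (hC : ∀ v, ‖b v‖ ^ 2 ≤ C * ‖v‖ ^ 2) :
    t2 tr (b * x) ≤ C * t2 tr x := by
  have h1 : star x * (star b * b) * x ≤ (C : ℂ) • (star x * x) := by
    rw [← sub_nonneg]
    apply nonneg_of_inner
    · simp [mul_assoc]
    · intro v
      have e1 := inner_star_mul (b * x) v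
      have e2 := inner_star_mul x v
      have : star x * (star b * b) * x = star (b * x) * (b * x) := by simp [mul_assoc]
      rw [this, sub_apply, smul_apply, inner_sub_left,
        inner_smul_left, Complex.sub_re, e1, Complex.conj_ofReal, Complex.re_ofReal_mul, e2]
      have := hC (x v)
      simpa using this
  have h2 := tr_mono tr (mul_mem (mul_mem (star_mem hx) (mul_mem (star_mem hb) hb)) hx)
    (csmul_mem M _ (mul_mem (star_mem hx) hx)) h1
  have : star x * (star b * b) * x = star (b * x) * (b * x) := by simp [mul_assoc]
  rw [this, map_smul, smul_eq_mul, Complex.re_ofReal_mul] at h2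
  exact h2

theorem t2_mul_le' {b x : H →L[ℂ] H} (hb : b ∈ M) (hx : x ∈ M) :
    t2 tr (b * x) ≤ ‖b‖ ^ 2 * t2 tr x := by
  apply t2_mul_le tr hb hx
  intro v
  rw [← mul_pow]
  exact pow_le_pow_left₀ (norm_nonneg _) (b.le_opNorm v) 2

theorem exists_sqrt0 {y : H →L[ℂ] H} (h : 0 ≤ y) :
    ∃ s : H →L[ℂ] H, star s = s ∧ s * s = y := by
  have h0 : 0 ≤ cfc Real.sqrt y := cfc_nonneg (fun t _ => Real.sqrt_nonneg t)
  refine ⟨cfc Real.sqrt y, pos_star h0, ?_⟩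
  rw [← cfc_mul Real.sqrt Real.sqrt y]
  conv_rhs => rw [← cfc_id' ℝ y]
  apply cfc_congr
  intro t ht
  exact Real.mul_self_sqrt (spectrum_nonneg_of_nonneg h ht)

theorem pos_apply_zero {n : H →L[ℂ] H} (hn : 0 ≤ n) (v : H) (h : (⟪n v, v⟫_ℂ).re ≤ 0) :
    n v = 0 := by
  obtain ⟨s, hss, e⟩ := exists_sqrt0 hn
  have h1 := inner_star_mul s v
  rw [hss, e] at h1
  have h2 : s v = 0 := by
    have : ‖s v‖ ^ 2 ≤ 0 := by linarith
    have := pow_eq_zero_iff (two_ne_zero) |>.1 (le_antisymm this (sq_nonneg _))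
    simpa using this
  rw [← e, mul_apply_eq_comp, h2, map_zero]

theorem cube_zero {n : H →L[ℂ] H} (hn : 0 ≤ n) (v : H) (h : (⟪n (n v), n v⟫_ℂ).re ≤ 0) :
    n v = 0 := by
  have h1 := pos_apply_zero hn (n v) h
  have h2 := inner_star_mul n v
  rw [pos_star hn, mul_apply_eq_comp, h1, inner_zero_left] at h2
  simpa using h2.symm

end CDX

namespace CDX
set_option linter.unusedSectionVars false
open CD
open scoped InnerProductSpace

variable {H : Type} [NormedAddCommGroup H] [InnerProductSpace ℂ H] [CompleteSpace H]
variable {M L : VonNeumannAlgebra H} {tr : TraceOn H (M : Set (H →L[ℂ] H))}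

theorem E_pos (E : CondExpOn H (M : Set (H →L[ℂ] H)) (L : Set (H →L[ℂ] H)) tr)
    (hLM : (L : Set (H →L[ℂ] H)) ⊆ M) {y : H →L[ℂ] H} (hy : y ∈ M) (h : 0 ≤ y) : 0 ≤ E.E y := by
  have hE : E.E y ∈ L := E.mem y hy
  have hs : star (E.E y) = E.E y := by rw [← E.star_map y hy, pos_star h]
  obtain ⟨a, ha, n, hn, ha0, hn0, e, hab, hba⟩ := exists_pos_neg L hE hs
  have hnM : n ∈ M := hLM hn
  have h1 : tr.τ (n * E.E y * n) = tr.τ (n * y * n) := by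
    rw [← E.bimod n hn n hn y hy]
    exact E.trace_eq _ (mul_mem (mul_mem hnM hy) hnM)
  have h2 : 0 ≤ (tr.τ (n * y * n)).re := by
    obtain ⟨s, hsM, -, hss, es⟩ := exists_sqrt M hy h
    have := t2_nonneg tr (mul_mem hsM hnM)
    rw [t2, star_mul, hss, pos_star hn0] at this
    rw [← es]
    simpa [mul_assoc] using this
  have h3 : n * E.E y * n = - (n * n * n) := by
    rw [e, mul_sub, hba]; simp
  have h4 : 0 ≤ n * n * n := by
    have := star_left_conjugate_nonneg hn0 n
    rwa [pos_star hn0] at this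
  have h5 : n * n * n = 0 := by
    apply tr_pos_zero tr (mul_mem (mul_mem hnM hnM) hnM) h4
    rw [← h1, h3, map_neg, Complex.neg_re] at h2
    linarith
  have h6 : n = 0 := by
    ext v
    have : n (n (n v)) = 0 := by
      have := congrArg (fun f : H →L[ℂ] H => f v) h5
      simpa using this
    apply cube_zero hn0 v
    have h7 : (⟪n (n v), n v⟫_ℂ) = ⟪n (n (n v)), v⟫_ℂ := by
      conv_rhs => rw [← pos_star hn0, inner_star]
      rw [pos_star hn0]
    rw [h7, this]; simp
  rw [e, h6, sub_zero]; exact ha0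

theorem E_mono (E : CondExpOn H (M : Set (H →L[ℂ] H)) (L : Set (H →L[ℂ] H)) tr)
    (hLM : (L : Set (H →L[ℂ] H)) ⊆ M) {x y : H →L[ℂ] H} (hx : x ∈ M) (hy : y ∈ M) (h : x ≤ y) :
    E.E x ≤ E.E y := by
  have := E_pos E hLM (sub_mem hy hx) (sub_nonneg.2 h)
  rw [map_sub] at this
  exact sub_nonneg.1 this

theorem inner_mono {x y : H →L[ℂ] H} (h : x ≤ y) (v : H) :
    (⟪x v, v⟫_ℂ).re ≤ (⟪y v, v⟫_ℂ).re := by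
  have := pos_inner (sub_nonneg.2 h) v
  rw [sub_apply, inner_sub_left, Complex.sub_re] at this
  linarith

/-- Schwarz inequality `E(x) E(x)* ≤ E(x x*)`. -/
theorem E_schwarz (E : CondExpOn H (M : Set (H →L[ℂ] H)) (L : Set (H →L[ℂ] H)) tr)
    (hLM : (L : Set (H →L[ℂ] H)) ⊆ M) {x : H →L[ℂ] H} (hx : x ∈ M) :
    E.E x * star (E.E x) ≤ E.E (x * star x) := by
  have hE : E.E x ∈ L := E.mem x hx
  have hEM : E.E x ∈ M := hLM hE
  have hEs : star (E.E x) ∈ L := star_mem hE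
  have h1 : 0 ≤ (x - E.E x) * star (x - E.E x) := mul_star_self_nonneg _
  have h2 := E_pos E hLM (mul_mem (sub_mem hx hEM) (star_mem (sub_mem hx hEM))) h1
  have e1 : (x - E.E x) * star (x - E.E x)
      = x * star x - 1 * x * star (E.E x) - E.E x * star x * 1 + 1 * (E.E x * star (E.E x)) * 1 := by
    rw [star_sub]; noncomm_ring
  have e2 := E.bimod 1 (one_mem L) _ hEs x hx
  have e3 := E.bimod _ hE 1 (one_mem L) (star x) (star_mem hx)
  have e4 := E.bimod 1 (one_mem L) 1 (one_mem L) (E.E x * star (E.E x)) (hLM (mul_mem hE hEs))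
  rw [e1, map_add, map_sub, map_sub, e2, e3, e4, E.star_map x hx, E.fix _ (mul_mem hE hEs)] at h2
  rw [← sub_nonneg]
  convert h2 using 1
  noncomm_ring

theorem PP (E : CondExpOn H (M : Set (H →L[ℂ] H)) (L : Set (H →L[ℂ] H)) tr)
    (hLM : (L : Set (H →L[ℂ] H)) ⊆ M) {k : ℕ} (m : Fin k → (H →L[ℂ] H)) (hm : ∀ i, m i ∈ M)
    (hb : ∀ x ∈ M, x = ∑ i, E.E (x * star (m i)) * m i) :
    ∃ C : ℝ, 0 ≤ C ∧ ∀ x ∈ M, ∀ v : H,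
      ‖(star x) v‖ ^ 2 ≤ C * (⟪(E.E (x * star x)) v, v⟫_ℂ).re := by
  refine ⟨(∑ i, ‖m i‖ ^ 2) ^ 2, sq_nonneg _, ?_⟩
  intro x hx v
  set R := (⟪(E.E (x * star x)) v, v⟫_ℂ).re with hR
  have hxx : x * star x ∈ M := mul_mem hx (star_mem hx)
  have hR0 : 0 ≤ R := pos_inner (E_pos E hLM hxx (mul_star_self_nonneg _)) v
  have key : ∀ i, ‖(star (E.E (x * star (m i)))) v‖ ≤ ‖m i‖ * Real.sqrt R := by
    intro i
    have hxm : x * star (m i) ∈ M := mul_mem hx (star_mem (hm i))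
    have h1 := inner_mono (E_schwarz E hLM hxm) v
    have h2 := inner_star_mul (star (E.E (x * star (m i)))) v
    rw [star_star] at h2
    have h3 : (x * star (m i)) * star (x * star (m i)) ≤ ((‖m i‖ ^ 2 : ℝ) : ℂ) • (x * star x) := by
      rw [← sub_nonneg]
      apply nonneg_of_inner
      · simp [mul_assoc]
      · intro w
        have e1 := inner_star_mul (star (x * star (m i))) w
        have e2 := inner_star_mul (star x) w
        rw [star_star] at e1 e2
        rw [sub_apply, smul_apply, inner_sub_left, inner_smul_left, Complex.sub_re, e1,
          Complex.conj_ofReal, Complex.re_ofReal_mul, e2]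
        have := (m i).le_opNorm ((star x) w)
        have e3 : (star (x * star (m i))) w = (m i) ((star x) w) := by simp
        rw [e3, sub_nonneg, ← mul_pow]
        exact pow_le_pow_left₀ (norm_nonneg _) this 2
    have h4 := inner_mono (E_mono E hLM (mul_mem hxm (star_mem hxm)) (csmul_mem M _ hxx) h3) v
    rw [map_smul, smul_apply, inner_smul_left, Complex.conj_ofReal, Complex.re_ofReal_mul,
      ← hR] at h4
    have h5 : ‖(star (E.E (x * star (m i)))) v‖ ^ 2 ≤ (‖m i‖ * Real.sqrt R) ^ 2 := by
      rw [mul_pow, Real.sq_sqrt hR0]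
      linarith
    exact le_of_sq_le_sq h5 (by positivity)
  have h1 : (star x) v = ∑ i, (star (m i)) ((star (E.E (x * star (m i)))) v) := by
    conv_lhs => rw [hb x hx]
    simp [star_sum]
  have h2 : ‖(star x) v‖ ≤ (∑ i, ‖m i‖ ^ 2) * Real.sqrt R := by
    rw [h1, Finset.sum_mul]
    refine (norm_sum_le _ _).trans (Finset.sum_le_sum fun i _ => ?_)
    refine ((star (m i)).le_opNorm _).trans ?_
    rw [norm_star, sq, mul_assoc]
    exact mul_le_mul_of_nonneg_left (key i) (norm_nonneg _)
  calc ‖(star x) v‖ ^ 2 ≤ ((∑ i, ‖m i‖ ^ 2) * Real.sqrt R) ^ 2 :=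
        pow_le_pow_left₀ (norm_nonneg _) h2 2
    _ = _ := by rw [mul_pow, Real.sq_sqrt hR0]

end CDX

namespace CDX
set_option linter.unusedSectionVars false
open CD
open scoped InnerProductSpace
variable {H : Type} [NormedAddCommGroup H] [InnerProductSpace ℂ H] [CompleteSpace H]
variable {M : VonNeumannAlgebra H} (tr : TraceOn H (M : Set (H →L[ℂ] H)))

theorem contraction {X : H →L[ℂ] H} (hX : X ∈ M) {δ : ℝ} (hδ : 0 < δ) :
    ∃ s ∈ M, star s = s ∧ (∀ v, ‖s v‖ ≤ ‖v‖) ∧ t2 tr s ≤ t2 tr X / δ ^ 2 ∧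
      ∀ v, ‖X v - s (X v)‖ ≤ δ * ‖v‖ := by
  have hd2 : 0 < δ ^ 2 := by positivity
  set y := X * star X with hy
  have hyM : y ∈ M := mul_mem hX (star_mem hX)
  have hy0 : 0 ≤ y := mul_star_self_nonneg X
  have hsa : IsSelfAdjoint y := IsSelfAdjoint.of_nonneg hy0
  have hsp : ∀ t ∈ spectrum ℝ y, 0 ≤ t := fun t ht => spectrum_nonneg_of_nonneg hy0 ht
  let f : ℝ → ℝ := fun t => t / (δ ^ 2 + |t|)
  have hden : ∀ t : ℝ, 0 < δ ^ 2 + |t| := fun t => by positivity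
  have hf : Continuous f := by
    apply Continuous.div continuous_id (by fun_prop) (fun t => (hden t).ne')
  have hf0 : ∀ t, 0 ≤ t → 0 ≤ f t := fun t ht => div_nonneg ht (hden t).le
  have hf1 : ∀ t, 0 ≤ t → f t ≤ 1 := fun t ht => by
    rw [div_le_one (hden t), abs_of_nonneg ht]; linarith
  have hff : ∀ t, 0 ≤ t → f t * f t ≤ (δ^2)⁻¹ * t := fun t ht => by
    have h1 : f t ≤ (δ^2)⁻¹ * t := by
      show t / (δ ^ 2 + |t|) ≤ _
      rw [div_eq_mul_inv, mul_comm]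
      apply mul_le_mul_of_nonneg_right _ ht
      apply inv_anti₀ hd2
      have := abs_nonneg t; linarith
    nlinarith [hf0 t ht, hf1 t ht]
  have hg : ∀ t, 0 ≤ t → |(1 - f t) * t * (1 - f t)| ≤ δ ^ 2 := fun t ht => by
    have e : (1 - f t) * t = δ^2 * f t := by
      show (1 - t / (δ ^ 2 + |t|)) * t = δ^2 * (t / (δ ^ 2 + |t|))
      have := (hden t).ne'
      rw [abs_of_nonneg ht] at *
      field_simp; ring
    rw [e, abs_of_nonneg]
    · have := hf0 t ht; have := hf1 t ht
      have : f t * (1 - f t) ≤ 1 := by nlinarith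
      calc _ = δ^2 * (f t * (1 - f t)) := by ring
        _ ≤ _ := by nlinarith
    · have := hf0 t ht; have := hf1 t ht
      have : 0 ≤ 1 - f t := by linarith
      positivity
  set s := cfc f y with hs
  have hs0 : 0 ≤ s := cfc_nonneg (fun t ht => hf0 t (hsp t ht))
  have hss := pos_star hs0
  have hsM : s ∈ M := cfc_mem M hyM hsa f
  have hsn : ‖s‖ ≤ 1 := norm_cfc_le zero_le_one (fun t ht => by
    rw [Real.norm_of_nonneg (hf0 t (hsp t ht))]; exact hf1 t (hsp t ht))
  refine ⟨s, hsM, hss, fun v => ?_, ?_, fun v => ?_⟩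
  · exact (s.le_opNorm v).trans (by nlinarith [norm_nonneg v])
  · have h1 : s * s ≤ (δ^2)⁻¹ • y := by
      rw [hs, ← cfc_mul f f y hf.continuousOn hf.continuousOn]
      have : (δ^2)⁻¹ • y = cfc (fun t : ℝ => (δ^2)⁻¹ * t) y := by
        rw [cfc_const_mul_id (δ^2)⁻¹ y]
      rw [this]
      exact cfc_mono (fun t ht => hff t (hsp t ht)) ((hf.mul hf).continuousOn) (by fun_prop)
    have e1 : (δ^2)⁻¹ • y = (((δ^2)⁻¹ : ℝ) : ℂ) • y := (RCLike.real_smul_eq_coe_smul (K := ℂ) _ _)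
    rw [e1] at h1
    have h2 := tr_mono tr (mul_mem hsM hsM) (csmul_mem M _ hyM) h1
    rw [map_smul, smul_eq_mul, Complex.re_ofReal_mul] at h2
    have h3 := t2_star tr hX
    unfold t2 at h3 ⊢
    rw [star_star] at h3
    rw [hss, ← h3, div_eq_mul_inv, mul_comm]
    exact h2
  · have h1 : ‖((1 - s) * X) * star ((1 - s) * X)‖ ≤ δ ^ 2 := by
      have e : ((1 - s) * X) * star ((1 - s) * X) = cfc (fun t : ℝ => (1 - f t) * t * (1 - f t)) y := by
        rw [cfc_mul (fun t : ℝ => (1 - f t) * t) (fun t : ℝ => 1 - f t) y (by fun_prop) (by fun_prop),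
          cfc_mul (fun t : ℝ => (1 - f t)) (fun t : ℝ => t) y (by fun_prop) (by fun_prop),
          cfc_sub (fun t : ℝ => 1) f y (by fun_prop) (by fun_prop), cfc_id' ℝ y, cfc_const_one ℝ y]
        rw [star_mul, star_sub, star_one, hss]
        simp only [hy, mul_assoc]
        rfl
      rw [e]
      exact norm_cfc_le hd2.le (fun t ht => hg t (hsp t ht))
    rw [CStarRing.norm_self_mul_star] at h1
    have h2 : ‖(1 - s) * X‖ ≤ δ := by nlinarith [norm_nonneg ((1-s)*X)]
    have h3 := ((1 - s) * X).le_opNorm v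
    have e : ((1 - s) * X) v = X v - s (X v) := by
      simp [mul_apply_eq_comp, sub_apply]
    rw [e] at h3
    exact h3.trans (mul_le_mul_of_nonneg_right h2 (norm_nonneg v))

end CDX

namespace CDX
set_option linter.unusedSectionVars false
open CD
open scoped InnerProductSpace
variable {H : Type} [NormedAddCommGroup H] [InnerProductSpace ℂ H] [CompleteSpace H]
variable {M : VonNeumannAlgebra H} (tr : TraceOn H (M : Set (H →L[ℂ] H)))

open Filter Topology

theorem sq_le_inner {d : H →L[ℂ] H} (h0 : 0 ≤ d) (h1 : d ≤ 1) (v : H) :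
    ‖d v‖ ^ 2 ≤ (⟪d v, v⟫_ℂ).re := by
  obtain ⟨s, hs, e⟩ := exists_sqrt0 h0
  have e1 : ∀ w, ‖s w‖ ^ 2 = (⟪d w, w⟫_ℂ).re := fun w => by
    rw [← inner_star_mul s w, hs, e]
  have e2 : d v = s (s v) := by rw [← e]; rfl
  rw [← e1, e2, e1]
  have := inner_mono h1 (s v)
  refine this.trans (le_of_eq ?_)
  have h := inner_self_eq_norm_sq (𝕜 := ℂ) (s v)
  simpa using h

theorem dec_limit (f : ℕ → H →L[ℂ] H) (hM : ∀ n, f n ∈ M) (h0 : ∀ n, 0 ≤ f n) (h1 : ∀ n, f n ≤ 1)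
    (ha : Antitone f) :
    ∃ F ∈ M, 0 ≤ F ∧ (∀ n, F ≤ f n) ∧ ∀ v, Tendsto (fun n => f n v) atTop (𝓝 (F v)) := by
  have hc : ∀ v, ∃ w, Tendsto (fun n => f n v) atTop (𝓝 w) := by
    intro v
    apply cauchySeq_tendsto_of_complete
    have hφ : Antitone (fun n => (⟪f n v, v⟫_ℂ).re) := fun m n h => inner_mono (ha h) v
    have hb : BddBelow (Set.range (fun n => (⟪f n v, v⟫_ℂ).re)) :=
      ⟨0, by rintro _ ⟨n, rfl⟩; exact pos_inner (h0 n) v⟩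
    have hcs : CauchySeq (fun n => (⟪f n v, v⟫_ℂ).re) := (tendsto_atTop_ciInf hφ hb).cauchySeq
    rw [Metric.cauchySeq_iff'] at hcs ⊢
    intro ε hε
    obtain ⟨N, hN⟩ := hcs (ε ^ 2) (by positivity)
    refine ⟨N, fun n hn => ?_⟩
    have h2 := hN n hn
    have hd0 : 0 ≤ f N - f n := sub_nonneg.2 (ha hn)
    have hd1 : f N - f n ≤ 1 := (sub_le_self _ (h0 n)).trans (h1 N)
    have h3 := sq_le_inner hd0 hd1 v
    rw [Real.dist_eq] at h2
    rw [sub_apply, inner_sub_left, Complex.sub_re] at h3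
    rw [dist_eq_norm, norm_sub_rev]
    have h4 := neg_abs_le ((⟪f n v, v⟫_ℂ).re - (⟪f N v, v⟫_ℂ).re)
    apply lt_of_pow_lt_pow_left₀ 2 hε.le
    linarith
  choose F hF using hc
  let G : H →L[ℂ] H := continuousLinearMapOfTendsto f (tendsto_pi_nhds.2 hF)
  have hG : ∀ v, G v = F v := fun v => rfl
  have hin : ∀ v w, Tendsto (fun n => ⟪f n v, w⟫_ℂ) atTop (𝓝 ⟪G v, w⟫_ℂ) := fun v w =>
    ((hF v).inner tendsto_const_nhds)
  have hstar : star G = G := by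
    ext v
    apply ext_inner_right ℂ
    intro w
    rw [inner_star]
    have a := hin w v
    have b := hin v w
    have c := (Complex.continuous_conj.tendsto _).comp a
    rw [inner_conj_symm] at c
    refine tendsto_nhds_unique c (b.congr fun n => ?_)
    simp only [Function.comp]
    rw [inner_conj_symm, ← inner_star, pos_star (h0 n)]
  have hre : ∀ v, Tendsto (fun n => (⟪f n v, v⟫_ℂ).re) atTop (𝓝 (⟪G v, v⟫_ℂ).re) := fun v =>
    (Complex.continuous_re.tendsto _).comp (hin v v)
  refine ⟨G, ?_, ?_, ?_, hF⟩
  · apply mem_of_comm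
    intro c hc
    ext v
    have a := (c.continuous.tendsto _).comp (hF v)
    have b := hF (c v)
    refine tendsto_nhds_unique a (b.congr fun n => ?_)
    have := (VonNeumannAlgebra.mem_commutant_iff.1 hc) (f n) (hM n)
    exact congrArg (fun T : H →L[ℂ] H => T v) this
  · exact nonneg_of_inner hstar fun v => ge_of_tendsto' (hre v) fun n => pos_inner (h0 n) v
  · intro n
    rw [← sub_nonneg]
    apply nonneg_of_inner
    · rw [star_sub, hstar, pos_star (h0 n)]
    · intro v
      rw [sub_apply, inner_sub_left, Complex.sub_re, sub_nonneg]
      apply le_of_tendsto (hre v)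
      filter_upwards [eventually_ge_atTop n] with m hm
      exact inner_mono (ha hm) v

theorem sing_step {ξ : H} (h : ∀ ε : ℝ, 0 < ε → ∃ x ∈ M, t2 tr x ≤ ε ∧ ‖x ξ - ξ‖ ≤ ε)
    {y : H →L[ℂ] H} (hy : y ∈ M) {ε : ℝ} (hε : 0 < ε) :
    ∃ s ∈ M, star s = s ∧ (∀ v, ‖s v‖ ≤ ‖v‖) ∧ t2 tr s ≤ ε ∧ ‖s (y ξ) - y ξ‖ ≤ ε := by
  set B := ‖y‖ + 1 with hB
  have hB0 : 0 < B := by positivity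
  set δ := ε / (4 * (‖ξ‖ + 1)) with hδ
  have hδ0 : 0 < δ := by positivity
  have hδ1 : δ * ‖ξ‖ ≤ ε / 4 := by
    have : δ * (‖ξ‖ + 1) = ε / 4 := by rw [hδ]; field_simp
    nlinarith
  obtain ⟨x, hx, hx1, hx2⟩ := h (min (ε / (4 * B)) (ε * δ ^ 2 / B ^ 2)) (by positivity)
  have hx1' := hx1.trans (min_le_right _ _)
  have hx2' := hx2.trans (min_le_left _ _)
  obtain ⟨s, hs, hss, hsc, hst, hsX⟩ := contraction tr (mul_mem hy hx) hδ0
  refine ⟨s, hs, hss, hsc, ?_, ?_⟩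
  · refine hst.trans ?_
    rw [div_le_iff₀ (by positivity)]
    refine (t2_mul_le' tr hy hx).trans ?_
    have h1 : ‖y‖ ^ 2 ≤ B ^ 2 := by
      apply pow_le_pow_left₀ (norm_nonneg y); linarith
    calc ‖y‖ ^ 2 * t2 tr x ≤ B ^ 2 * (ε * δ ^ 2 / B ^ 2) :=
          mul_le_mul h1 hx1' (t2_nonneg tr hx) (by positivity)
      _ = ε * δ ^ 2 := by field_simp
  · have h1 := hsX ξ
    rw [mul_apply_eq_comp] at h1
    have h2 : ‖y (x ξ) - y ξ‖ ≤ ε / 4 := by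
      rw [← map_sub]
      refine (y.le_opNorm _).trans ?_
      calc ‖y‖ * ‖x ξ - ξ‖ ≤ B * (ε / (4 * B)) :=
            mul_le_mul (by linarith) hx2' (norm_nonneg _) hB0.le
        _ = ε / 4 := by field_simp
    have h3 : ‖s (y (x ξ) - y ξ)‖ ≤ ε / 4 := (hsc _).trans h2
    have e : s (y ξ) - y ξ = (y (x ξ) - y ξ) - s (y (x ξ) - y ξ) - (y (x ξ) - s (y (x ξ))) := by
      rw [map_sub]; abel
    rw [e]
    have h4 := norm_sub_le ((y (x ξ) - y ξ) - s (y (x ξ) - y ξ)) (y (x ξ) - s (y (x ξ)))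
    have h5 := norm_sub_le (y (x ξ) - y ξ) (s (y (x ξ) - y ξ))
    linarith

theorem sing {ξ : H} (h0 : ξ ≠ 0) (h : ∀ ε : ℝ, 0 < ε → ∃ x ∈ M, t2 tr x ≤ ε ∧ ‖x ξ - ξ‖ ≤ ε) :
    False := by
  have hn : 0 < ‖ξ‖ := norm_pos_iff.2 h0
  let e : ℕ → ℝ := fun n => ‖ξ‖ / 4 * (1 / 2) ^ n
  have he : ∀ n, 0 < e n := fun n => by positivity
  have hstep : ∀ (y : M) (n : ℕ), ∃ s : M, star (s : H →L[ℂ] H) = s ∧ (∀ v, ‖(s : H →L[ℂ] H) v‖ ≤ ‖v‖) ∧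
      t2 tr s ≤ e n ∧ ‖(s : H →L[ℂ] H) ((y : H →L[ℂ] H) ξ) - (y : H →L[ℂ] H) ξ‖ ≤ e n := by
    intro y n
    obtain ⟨s, hs, r⟩ := sing_step tr h y.2 (he n)
    exact ⟨⟨s, hs⟩, r⟩
  choose S hS1 hS2 hS3 hS4 using hstep
  let g' : ℕ → M := fun n => Nat.rec ⟨1, one_mem M⟩ (fun n y => ⟨(S y n : H →L[ℂ] H) * (y : H →L[ℂ] H), mul_mem (S y n).2 y.2⟩) n
  let g : ℕ → H →L[ℂ] H := fun n => (g' n).1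
  have hg0 : g 0 = 1 := rfl
  have hgs : ∀ n, g (n + 1) = (S (g' n) n : H →L[ℂ] H) * g n := fun n => rfl
  have hgM : ∀ n, g n ∈ M := fun n => (g' n).2
  have hdec : ∀ n v, ‖g (n + 1) v‖ ≤ ‖g n v‖ := fun n v => by
    rw [hgs]; exact hS2 _ _ _
  have hcon : ∀ n v, ‖g n v‖ ≤ ‖v‖ := fun n v => by
    induction n with
    | zero => rw [hg0]; rfl
    | succ n ih => exact (hdec n v).trans ih
  let f : ℕ → H →L[ℂ] H := fun n => star (g n) * g n
  have hfin : ∀ n v, (⟪f n v, v⟫_ℂ).re = ‖g n v‖ ^ 2 := fun n v => inner_star_mul _ _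
  have hf0 : ∀ n, 0 ≤ f n := fun n => star_mul_self_nonneg _
  have hf1 : ∀ n, f n ≤ 1 := fun n => by
    rw [← sub_nonneg]
    apply nonneg_of_inner
    · rw [star_sub, pos_star (hf0 n), star_one]
    · intro v
      rw [sub_apply, inner_sub_left, Complex.sub_re, hfin, sub_nonneg]
      have h2 := inner_self_eq_norm_sq (𝕜 := ℂ) v
      have h3 : (⟪(1 : H →L[ℂ] H) v, v⟫_ℂ).re = ‖v‖ ^ 2 := by simpa using h2
      rw [h3]
      exact pow_le_pow_left₀ (norm_nonneg _) (hcon n v) 2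
  have hfa : Antitone f := antitone_nat_of_succ_le fun n => by
    rw [← sub_nonneg]
    apply nonneg_of_inner
    · rw [star_sub, pos_star (hf0 n), pos_star (hf0 (n+1))]
    · intro v
      rw [sub_apply, inner_sub_left, Complex.sub_re, hfin n, hfin (n+1), sub_nonneg]
      exact pow_le_pow_left₀ (norm_nonneg _) (hdec n v) 2
  obtain ⟨F, hFM, hF0, hFle, hFt⟩ := dec_limit f (fun n => mul_mem (star_mem (hgM n)) (hgM n)) hf0 hf1 hfa
  have htr : ∀ n, (tr.τ F).re ≤ e n := fun n => by
    have h1 := tr_mono tr hFM (mul_mem (star_mem (hgM (n+1))) (hgM (n+1))) (hFle (n + 1))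
    refine h1.trans ?_
    change t2 tr (g (n+1)) ≤ _
    rw [← t2_star tr (hgM (n+1)), hgs n, star_mul, hS1]
    have h2 := t2_mul_le tr (star_mem (hgM n)) (S (g' n) n).2 (C := 1) (by
      intro v
      have h3 : ‖star (g n)‖ ≤ 1 := by
        rw [norm_star]
        exact (g n).opNorm_le_bound zero_le_one (fun v => by rw [one_mul]; exact hcon n v)
      have h4 := (star (g n)).le_opNorm v
      rw [one_mul]
      apply pow_le_pow_left₀ (norm_nonneg _)
      nlinarith [norm_nonneg v])
    rw [one_mul] at h2
    exact h2.trans (hS3 _ _)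
  have hlim : Tendsto e atTop (𝓝 0) := by
    have := (tendsto_pow_atTop_nhds_zero_of_lt_one (r := (1/2 : ℝ)) (by norm_num) (by norm_num)).const_mul (‖ξ‖/4)
    rw [mul_zero] at this
    exact this
  have hF : F = 0 := tr_pos_zero tr hFM hF0 (ge_of_tendsto' hlim htr)
  have hlow : ∀ n, ‖ξ‖ / 2 + ‖ξ‖ / 2 * (1/2) ^ n ≤ ‖g n ξ‖ := fun n => by
    induction n with
    | zero => rw [hg0]; simp
    | succ n ih =>
      have h1 := hS4 (g' n) n
      have h2 : ‖g (n+1) ξ - g n ξ‖ ≤ e n := h1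
      have h3 := norm_sub_norm_le (g n ξ) (g (n+1) ξ)
      rw [norm_sub_rev] at h3
      have h4 : e n = ‖ξ‖ / 4 * (1/2)^n := rfl
      rw [pow_succ]
      linarith
  have hT : Tendsto (fun n => ‖g n ξ‖ ^ 2) atTop (𝓝 0) := by
    have h1 := (Complex.continuous_re.tendsto _).comp ((hFt ξ).inner (tendsto_const_nhds (x := ξ)) (𝕜 := ℂ))
    rw [hF] at h1
    simp only [zero_apply, inner_zero_left, Complex.zero_re] at h1
    exact h1.congr fun n => hfin n ξ
  have h5 : (‖ξ‖ / 2) ^ 2 ≤ 0 := ge_of_tendsto' hT fun n => by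
    apply pow_le_pow_left₀ (by positivity)
    have : 0 ≤ ‖ξ‖ / 2 * (1/2) ^ n := by positivity
    linarith [hlow n]
  nlinarith [sq_nonneg ‖ξ‖]

end CDX

namespace CDX
set_option linter.unusedSectionVars false
open CD
open scoped InnerProductSpace
variable {H : Type} [NormedAddCommGroup H] [InnerProductSpace ℂ H] [CompleteSpace H]
variable {M : VonNeumannAlgebra H} (tr : TraceOn H (M : Set (H →L[ℂ] H)))

open Filter Topology

theorem t2_exp {x z : H →L[ℂ] H} (hx : x ∈ M) (hz : z ∈ M) (t : ℝ) :
    t2 tr (x + (t : ℂ) • z) = t2 tr x + 2 * t * (tr.τ (star x * z)).re + t ^ 2 * t2 tr z := by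
  have h1 : tr.τ (star z * x) = starRingEnd ℂ (tr.τ (star x * z)) := by
    rw [← tr.star_eq _ (mul_mem (star_mem hx) hz), star_mul, star_star]
  have h2 : star (x + (t : ℂ) • z) * (x + (t : ℂ) • z) =
      star x * x + (t : ℂ) • (star x * z) + (t : ℂ) • (star z * x) + ((t : ℂ) * (t : ℂ)) • (star z * z) := by
    rw [star_add, star_smul, add_mul, mul_add, mul_add]
    simp only [smul_mul_assoc, mul_smul_comm, smul_smul]
    have : star (t : ℂ) = (t : ℂ) := Complex.conj_ofReal t
    rw [this]
    abel
  unfold t2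
  rw [h2]
  simp only [map_add, map_smul, smul_eq_mul, h1, ← Complex.ofReal_mul, Complex.add_re,
    Complex.re_ofReal_mul, Complex.conj_re]
  ring

theorem norm_exp (v w : H) (t : ℝ) :
    ‖v + (t : ℂ) • w‖ ^ 2 = ‖v‖ ^ 2 + 2 * t * (⟪v, w⟫_ℂ).re + t ^ 2 * ‖w‖ ^ 2 := by
  have h1 := norm_add_sq (𝕜 := ℂ) v ((t : ℂ) • w)
  rw [inner_smul_right, norm_smul] at h1
  rw [h1]
  have : RCLike.re ((t : ℂ) * ⟪v, w⟫_ℂ) = t * (⟪v, w⟫_ℂ).re := Complex.re_ofReal_mul _ _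
  rw [this, mul_pow, Complex.norm_real, Real.norm_eq_abs, sq_abs]
  ring

def QQ (ξ : H) (y : H →L[ℂ] H) : ℝ := t2 tr (1 - y) + ‖y ξ‖ ^ 2
def BB (ξ : H) (y z : H →L[ℂ] H) : ℝ := -(tr.τ (star (1 - y) * z)).re + (⟪y ξ, z ξ⟫_ℂ).re
def NN (ξ : H) (z : H →L[ℂ] H) : ℝ := t2 tr z + ‖z ξ‖ ^ 2

theorem QQ_exp (ξ : H) {y z : H →L[ℂ] H} (hy : y ∈ M) (hz : z ∈ M) (t : ℝ) :
    QQ tr ξ (y + (t : ℂ) • z) = QQ tr ξ y + 2 * t * BB tr ξ y z + t ^ 2 * NN tr ξ z := by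
  unfold QQ BB NN
  have e : 1 - (y + (t : ℂ) • z) = (1 - y) + ((-t : ℝ) : ℂ) • z := by
    push_cast; rw [neg_smul]; abel
  rw [e, t2_exp tr (sub_mem (one_mem M) hy) hz, add_apply, smul_apply, norm_exp]
  ring

theorem BB_sq (ξ : H) {d e : ℝ} (hd : ∀ y ∈ M, d ≤ QQ tr ξ y) {y z : H →L[ℂ] H} (hy : y ∈ M)
    (hz : z ∈ M) (he : QQ tr ξ y ≤ d + e) : BB tr ξ y z ^ 2 ≤ e * NN tr ξ z := by
  have h : ∀ t : ℝ, 0 ≤ NN tr ξ z * (t * t) + (2 * BB tr ξ y z) * t + e := fun t => by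
    have h1 := hd _ (add_mem hy (csmul_mem M (t : ℂ) hz))
    rw [QQ_exp tr ξ hy hz] at h1
    nlinarith
  have := discrim_le_zero h
  unfold discrim at this
  nlinarith

theorem BB_le (ξ : H) {d e K : ℝ} (hd : ∀ y ∈ M, d ≤ QQ tr ξ y) {y z : H →L[ℂ] H} (hy : y ∈ M)
    (hz : z ∈ M) (he : QQ tr ξ y ≤ d + e) (he0 : 0 ≤ e) (hK : NN tr ξ z ≤ K) :
    |BB tr ξ y z| ≤ Real.sqrt (e * K) := by
  apply Real.abs_le_sqrt
  exact (BB_sq tr ξ hd hy hz he).trans (mul_le_mul_of_nonneg_left hK he0)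

theorem NN_le (ξ : H) {d e e' : ℝ} (hd : ∀ y ∈ M, d ≤ QQ tr ξ y) {y y' : H →L[ℂ] H} (hy : y ∈ M)
    (hy' : y' ∈ M) (he : QQ tr ξ y ≤ d + e) (he' : QQ tr ξ y' ≤ d + e') :
    NN tr ξ (y' - y) ≤ 2 * (e + e') := by
  have hz := sub_mem hy' hy
  have h1 := QQ_exp tr ξ hy hz 1
  have h2 := QQ_exp tr ξ hy hz (1/2)
  have h3 := hd _ (add_mem hy (csmul_mem M ((1/2 : ℝ) : ℂ) hz))
  have e1 : y + ((1 : ℝ) : ℂ) • (y' - y) = y' := by simp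
  rw [e1] at h1
  rw [h2] at h3
  linarith

theorem t2_sub_le {x y : H →L[ℂ] H} (hx : x ∈ M) (hy : y ∈ M) :
    t2 tr (x - y) ≤ 2 * t2 tr x + 2 * t2 tr y := by
  have h1 := t2_exp tr hx hy 1
  have h2 := t2_exp tr hx hy (-1)
  have h3 := t2_nonneg tr (add_mem hx (csmul_mem M ((1 : ℝ) : ℂ) hy))
  have e : x + ((-1 : ℝ) : ℂ) • y = x - y := by simp [sub_eq_add_neg]
  rw [e] at h2
  rw [h1] at h3
  rw [h2]
  linarith

theorem domvec {ξ : H} (h0 : ξ ≠ 0) :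
    ∃ η : H, (∃ x ∈ M, ⟪η, x ξ⟫_ℂ ≠ 0) ∧ ∀ x ∈ M, ‖x η‖ ^ 2 ≤ t2 tr x := by
  set d : ℝ := sInf ((QQ tr ξ) '' (M : Set (H →L[ℂ] H))) with hdd
  have hbdd : BddBelow ((QQ tr ξ) '' (M : Set (H →L[ℂ] H))) := by
    refine ⟨0, ?_⟩
    rintro _ ⟨y, hy, rfl⟩
    exact add_nonneg (t2_nonneg tr (sub_mem (one_mem M) hy)) (sq_nonneg _)
  have hd : ∀ y ∈ M, d ≤ QQ tr ξ y := fun y hy => csInf_le hbdd ⟨y, hy, rfl⟩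
  let e : ℕ → ℝ := fun n => 1 / ((n : ℝ) + 1)
  have he : ∀ n, 0 < e n := fun n => by positivity
  have he1 : ∀ n, e n ≤ 1 := fun n => by
    rw [div_le_one (by positivity)]; have : (0:ℝ) ≤ n := by positivity
    linarith
  have helim : Tendsto e atTop (𝓝 0) := tendsto_one_div_add_atTop_nhds_zero_nat
  have hex : ∀ n, ∃ y ∈ M, QQ tr ξ y ≤ d + e n := fun n => by
    obtain ⟨_, ⟨y, hy, rfl⟩, h⟩ := exists_lt_of_csInf_lt (s := (QQ tr ξ) '' (M : Set (H →L[ℂ] H)))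
      ⟨_, 0, zero_mem M, rfl⟩ (b := d + e n) (by rw [← hdd]; linarith [he n])
    exact ⟨y, hy, h.le⟩
  choose y hyM hyQ using hex
  have hb1 : ∀ n, t2 tr (1 - y n) ≤ d + 1 := fun n => by
    have := hyQ n; unfold QQ at this
    nlinarith [he1 n, sq_nonneg ‖y n ξ‖]
  have hb2 : ∀ n, ‖y n ξ‖ ^ 2 ≤ d + 1 := fun n => by
    have := hyQ n; unfold QQ at this
    nlinarith [he1 n, t2_nonneg tr (sub_mem (one_mem M) (hyM n))]
  have hb3 : ∀ n, t2 tr (y n) ≤ 2 + 2 * (d + 1) := fun n => by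
    have := t2_sub_le tr (one_mem M) (sub_mem (one_mem M) (hyM n))
    rw [sub_sub_cancel] at this
    have h1 : t2 tr 1 = 1 := by simp [t2, tr.unital]
    linarith [hb1 n]
  have hcs : CauchySeq (fun n => y n ξ) := by
    rw [Metric.cauchySeq_iff']
    intro ε hε
    obtain ⟨N, hN⟩ := (helim.eventually (gt_mem_nhds (show (0:ℝ) < ε ^ 2 / 4 by positivity))).exists_forall_of_atTop
    refine ⟨N, fun n hn => ?_⟩
    have h1 := NN_le tr ξ hd (hyM N) (hyM n) (hyQ N) (hyQ n)
    have h2 := hN n hn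
    have h3 := hN N le_rfl
    unfold NN at h1
    have h4 := t2_nonneg tr (sub_mem (hyM n) (hyM N))
    rw [sub_apply] at h1
    rw [dist_eq_norm]
    apply lt_of_pow_lt_pow_left₀ 2 hε.le
    linarith
  obtain ⟨η, hη⟩ := cauchySeq_tendsto_of_complete hcs
  have hsq : ∀ K : ℝ, Tendsto (fun n => Real.sqrt (e n * K)) atTop (𝓝 0) := fun K => by
    have := (helim.mul_const K)
    rw [zero_mul] at this
    have h2 := (Real.continuous_sqrt.tendsto 0).comp this
    rw [Real.sqrt_zero] at h2
    exact h2
  refine ⟨η, ?_, ?_⟩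
  · by_contra hcon
    push Not at hcon
    have hη0 : η = 0 := by
      have h1 : Tendsto (fun n => ⟪η, y n ξ⟫_ℂ) atTop (𝓝 ⟪η, η⟫_ℂ) := tendsto_const_nhds.inner hη
      have h2 : ⟪η, η⟫_ℂ = 0 := tendsto_nhds_unique h1 (tendsto_const_nhds.congr fun n => (hcon _ (hyM n)).symm)
      exact inner_self_eq_zero.1 h2
    rw [hη0] at hη
    have hnorm : Tendsto (fun n => ‖y n ξ‖) atTop (𝓝 0) := by
      have := hη.norm; rwa [norm_zero] at this
    set K := (d + 1) + (2 * ‖ξ‖ ^ 2 + 2 * (d + 1)) with hK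
    have hNK : ∀ n, NN tr ξ (1 - y n) ≤ K := fun n => by
      unfold NN
      have h1 : ‖(1 - y n) ξ‖ ^ 2 ≤ 2 * ‖ξ‖ ^ 2 + 2 * ‖y n ξ‖ ^ 2 := by
        have h2 : ‖(1 - y n) ξ‖ ≤ ‖ξ‖ + ‖y n ξ‖ := norm_sub_le _ _
        have h3 := pow_le_pow_left₀ (norm_nonneg _) h2 2
        nlinarith [sq_nonneg (‖ξ‖ - ‖y n ξ‖)]
      linarith [hb1 n, hb2 n]
    have hkey : ∀ n, t2 tr (1 - y n) ≤ ‖y n ξ‖ * (‖ξ‖ + ‖y n ξ‖) + Real.sqrt (e n * K) := fun n => by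
      have h1 := BB_le tr ξ hd (hyM n) (sub_mem (one_mem M) (hyM n)) (hyQ n) (he n).le (hNK n)
      have h2 := (abs_le.1 h1).1
      have h3 : BB tr ξ (y n) (1 - y n) = - t2 tr (1 - y n) + (⟪y n ξ, (1 - y n) ξ⟫_ℂ).re := rfl
      have h4 : (⟪y n ξ, (1 - y n) ξ⟫_ℂ).re ≤ ‖y n ξ‖ * (‖ξ‖ + ‖y n ξ‖) := by
        refine (Complex.re_le_norm _).trans ((norm_inner_le_norm _ _).trans ?_)
        exact mul_le_mul_of_nonneg_left (norm_sub_le _ _) (norm_nonneg _)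
      linarith
    have hlim : Tendsto (fun n => ‖y n ξ‖ * (‖ξ‖ + ‖y n ξ‖) + Real.sqrt (e n * K)) atTop (𝓝 0) := by
      have := (hnorm.mul (hnorm.const_add ‖ξ‖)).add (hsq K)
      simpa using this
    refine sing tr h0 fun ε hε => ?_
    obtain ⟨n, h1, h2⟩ := ((hlim.eventually (gt_mem_nhds hε)).and
      (hnorm.eventually (gt_mem_nhds hε))).exists
    refine ⟨1 - y n, sub_mem (one_mem M) (hyM n), (hkey n).trans h1.le, ?_⟩
    have : (1 - y n) ξ - ξ = - y n ξ := by
      rw [sub_apply]; simp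
    rw [this, norm_neg]
    exact h2.le
  · intro x hx
    set c := ‖star x * x‖ with hc
    set K := c ^ 2 * (2 + 2 * (d + 1)) + c ^ 2 * (d + 1) with hK
    have hxx := mul_mem (star_mem hx) hx
    have hzM : ∀ n, star x * x * y n ∈ M := fun n => mul_mem hxx (hyM n)
    have hNK : ∀ n, NN tr ξ (star x * x * y n) ≤ K := fun n => by
      unfold NN
      apply add_le_add
      · refine (t2_mul_le' tr hxx (hyM n)).trans ?_
        exact mul_le_mul_of_nonneg_left (hb3 n) (sq_nonneg _)
      · have h1 : ‖(star x * x * y n) ξ‖ ≤ c * ‖y n ξ‖ := (star x * x).le_opNorm _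
        have h2 := pow_le_pow_left₀ (norm_nonneg _) h1 2
        rw [mul_pow] at h2
        exact h2.trans (mul_le_mul_of_nonneg_left (hb2 n) (sq_nonneg _))
    have hkey : ∀ n, ‖x (y n ξ)‖ ^ 2 ≤ t2 tr x + Real.sqrt (e n * K) := fun n => by
      have h1 := BB_le tr ξ hd (hyM n) (hzM n) (hyQ n) (he n).le (hNK n)
      have h2 := (abs_le.1 h1).2
      unfold BB at h2
      have h3 : (⟪y n ξ, (star x * x * y n) ξ⟫_ℂ).re = ‖x (y n ξ)‖ ^ 2 := by
        rw [← inner_star_mul x, ← Complex.conj_re, inner_conj_symm]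
        rfl
      have e4 : star (1 - y n) * (star x * x * y n) = star x * (x * y n) - star (x * y n) * (x * y n) +
          (star (1 - y n) * (star x * x * y n) - star x * (x * y n) + star (x * y n) * (x * y n)) := by abel
      have hxy := mul_mem hx (hyM n)
      have h5 : (tr.τ (star (1 - y n) * (star x * x * y n))).re =
          (tr.τ (star x * (x * y n))).re - t2 tr (x * y n) := by
        have : star (1 - y n) * (star x * x * y n) = star x * (x * y n) - star (x * y n) * (x * y n) := by
          rw [star_sub, star_one, sub_mul, one_mul, star_mul]
          simp only [mul_assoc]
        rw [this, map_sub, Complex.sub_re]; rfl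
      have h6 := t2_exp tr hx hxy (-2)
      have h7 := t2_nonneg tr (add_mem hx (csmul_mem M ((-2 : ℝ) : ℂ) hxy))
      rw [h6] at h7
      rw [h3, h5] at h2
      have h8 := t2_nonneg tr hx
      linarith
    have h1 : Tendsto (fun n => ‖x (y n ξ)‖ ^ 2) atTop (𝓝 (‖x η‖ ^ 2)) :=
      (((x.continuous.tendsto _).comp hη).norm).pow 2
    have h2 : Tendsto (fun n => t2 tr x + Real.sqrt (e n * K)) atTop (𝓝 (t2 tr x + 0)) :=
      (hsq K).const_add _
    rw [add_zero] at h2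
    exact le_of_tendsto_of_tendsto' h1 h2 hkey

theorem domproj {q : H →L[ℂ] H} (hq : q ∈ M) (hqs : star q = q) (hqq : q * q = q) (hq0 : q ≠ 0) :
    ∃ η : H, η ≠ 0 ∧ q η = η ∧ ∃ K : ℝ, 0 < K ∧ ∀ x ∈ M, ‖x η‖ ^ 2 ≤ K * t2 tr x := by
  have : ∃ v, q v ≠ 0 := by
    by_contra h
    push Not at h
    exact hq0 (by ext v; simpa using h v)
  obtain ⟨v, hv⟩ := this
  obtain ⟨ζ, ⟨x, hx, hne⟩, hb⟩ := domvec tr hv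
  refine ⟨q (star x ζ), ?_, ?_, ‖x * q‖ ^ 2 + 1, by positivity, ?_⟩
  · intro h
    apply hne
    rw [← inner_star, ← inner_star, hqs, h, inner_zero_left]
  · rw [← mul_apply_eq_comp, hqq]
  · intro y hy
    have hm : star (x * q) ∈ M := star_mem (mul_mem hx hq)
    have h1 := hb (y * star (x * q)) (mul_mem hy hm)
    have e1 : (y * star (x * q)) ζ = y (q (star x ζ)) := by
      rw [star_mul, hqs]; rfl
    rw [e1] at h1
    refine h1.trans ?_
    rw [← t2_star tr (mul_mem hy hm), star_mul, star_star]
    refine (t2_mul_le' tr (mul_mem hx hq) (star_mem hy)).trans ?_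
    rw [t2_star tr hy]
    nlinarith [t2_nonneg tr hy]

end CDX

namespace CDX
set_option linter.unusedSectionVars false
open CD
open scoped InnerProductSpace
variable {H : Type} [NormedAddCommGroup H] [InnerProductSpace ℂ H] [CompleteSpace H]
open Filter Topology

theorem frame_op {ι : Type} (b : ι → H) {C : ℝ} (hC : 0 ≤ C)
    (hB : ∀ (F : Finset ι) (v : H), ∑ i ∈ F, ‖⟪b i, v⟫_ℂ‖ ^ 2 ≤ C * ‖v‖ ^ 2) :
    ∃ k : H →L[ℂ] H, ∀ v w, HasSum (fun i => starRingEnd ℂ ⟪b i, v⟫_ℂ * ⟪b i, w⟫_ℂ) ⟪k v, w⟫_ℂ := by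
  have h2 : (2 : ENNReal).toReal = 2 := by norm_num
  have hp : 0 < (2 : ENNReal).toReal := by norm_num
  have hmem : ∀ v, Memℓp (fun i => ⟪b i, v⟫_ℂ) 2 := fun v => by
    apply memℓp_gen' (C := C * ‖v‖ ^ 2)
    intro s
    rw [h2]
    simpa using hB s v
  let T0 : H →ₗ[ℂ] lp (fun _ : ι => ℂ) 2 :=
    { toFun := fun v => ⟨fun i => ⟪b i, v⟫_ℂ, hmem v⟩
      map_add' := fun v w => by
        ext i; exact inner_add_right _ _ _
      map_smul' := fun c v => by
        ext i; exact inner_smul_right _ _ _ }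
  have hT0 : ∀ v i, (T0 v : ι → ℂ) i = ⟪b i, v⟫_ℂ := fun v i => rfl
  let T : H →L[ℂ] lp (fun _ : ι => ℂ) 2 := T0.mkContinuous (Real.sqrt C) (fun v => by
    apply lp.norm_le_of_forall_sum_le hp (by positivity)
    intro s
    rw [h2]
    simp only [hT0]
    have := hB s v
    have e : (Real.sqrt C * ‖v‖) ^ (2:ℝ) = C * ‖v‖ ^ 2 := by
      rw [Real.rpow_two, mul_pow, Real.sq_sqrt hC]
    rw [e]
    simpa using this)
  refine ⟨(ContinuousLinearMap.adjoint T) ∘L T, fun v w => ?_⟩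
  have h := lp.hasSum_inner (𝕜 := ℂ) (T v) (T w)
  rw [ContinuousLinearMap.comp_apply, ContinuousLinearMap.adjoint_inner_left]
  refine h.congr_fun ?_ |> id
  intro i
  show _ = ⟪⟪b i, v⟫_ℂ, ⟪b i, w⟫_ℂ⟫_ℂ
  rw [RCLike.inner_apply, mul_comm]

variable {Γ : Type} [Group Γ]

theorem u_mem_L (X : CrossedProduct Γ H) (γ : Γ) : X.u γ ∈ X.Lg := by
  have : X.u γ ∈ (X.Lg : Set (H →L[ℂ] H)) := by
    rw [X.Lg_eq]
    exact Set.subset_centralizer_centralizer ⟨γ, rfl⟩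
  exact this

theorem mem_commutant_L (X : CrossedProduct Γ H) {k : H →L[ℂ] H}
    (h : ∀ γ, X.u γ * k = k * X.u γ) : k ∈ X.Lg.commutant := by
  rw [VonNeumannAlgebra.mem_commutant_iff]
  intro g hg
  have hg' : g ∈ (X.Lg : Set (H →L[ℂ] H)) := hg
  rw [X.Lg_eq] at hg'
  refine (hg' k ?_).symm
  rintro _ ⟨γ, rfl⟩
  exact h γ

theorem tr_au (X : CrossedProduct Γ H) {a : H →L[ℂ] H} (ha : a ∈ X.A) (γ δ : Γ) :
    X.tr.τ (star (X.u γ) * a * X.u δ) = if γ = δ then X.tr.τ a else 0 := by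
  have haM : a ∈ X.M := X.A_sub ha
  have e1 : X.tr.τ (star (X.u γ) * a * X.u δ) = X.tr.τ (a * X.u (δ * γ⁻¹)) := by
    rw [mul_assoc, X.tr.tracial _ (star_mem (X.u_mem γ)) _ (mul_mem haM (X.u_mem δ)), X.u_star,
      mul_assoc, X.u_mul]
  rw [e1]
  split_ifs with h
  · rw [h, mul_inv_cancel, X.u_one, mul_one]
  · have hne : δ * γ⁻¹ ≠ 1 := fun h1 => h (mul_inv_eq_one.1 h1).symm
    have h2 := X.EA.bimod a ha 1 (one_mem X.A) (X.u (δ * γ⁻¹)) (X.u_mem _)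
    rw [X.EA_u _ hne, mul_zero, zero_mul, mul_one] at h2
    rw [← X.EA.trace_eq _ (mul_mem haM (X.u_mem _)), h2, map_zero]

theorem t2_sg (X : CrossedProduct Γ H) {a s : H →L[ℂ] H} (ha : a ∈ X.A) (hs : s ∈ X.Lg)
    (hss : star s = s) (hse : s * s = X.EL.E a) (F : Finset Γ) (c : Γ → ℂ) :
    t2 X.tr (s * ∑ γ ∈ F, c γ • X.u γ) = (X.tr.τ a).re * ∑ γ ∈ F, ‖c γ‖ ^ 2 := by
  have haM : a ∈ X.M := X.A_sub ha
  set g := ∑ γ ∈ F, c γ • X.u γ with hg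
  have hgL : g ∈ X.Lg := sum_mem fun γ _ => csmul_mem X.Lg _ (u_mem_L X γ)
  have hgM : g ∈ X.M := X.Lg_sub hgL
  unfold t2
  have e1 : star (s * g) * (s * g) = X.EL.E (star g * a * g) := by
    rw [X.EL.bimod (star g) (star_mem hgL) g hgL a haM, ← hse, star_mul, hss]
    simp only [mul_assoc]
  have e2 : star g * a * g = ∑ γ ∈ F, ∑ δ ∈ F, (star (c γ) * c δ) • (star (X.u γ) * a * X.u δ) := by
    rw [hg, star_sum, Finset.sum_mul, Finset.sum_mul]
    refine Finset.sum_congr rfl fun γ _ => ?_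
    rw [Finset.mul_sum]
    refine Finset.sum_congr rfl fun δ _ => ?_
    rw [star_smul, smul_mul_assoc, smul_mul_assoc, mul_smul_comm, smul_smul]
  rw [e1, X.EL.trace_eq _ (mul_mem (mul_mem (star_mem hgM) haM) hgM), e2, map_sum]
  have e3 : ∀ γ ∈ F, X.tr.τ (∑ δ ∈ F, (star (c γ) * c δ) • (star (X.u γ) * a * X.u δ)) =
      ((‖c γ‖ ^ 2 : ℝ) : ℂ) * X.tr.τ a := by
    intro γ hγ
    rw [map_sum]
    simp only [map_smul, tr_au X ha, smul_eq_mul, mul_ite, mul_zero]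
    rw [Finset.sum_ite_eq, if_pos hγ]
    congr 1
    have := Complex.conj_mul' (c γ)
    push_cast
    exact this
  rw [Finset.sum_congr rfl e3, Complex.re_sum, Finset.mul_sum]
  refine Finset.sum_congr rfl fun γ _ => ?_
  rw [Complex.re_ofReal_mul, mul_comm]

theorem bessel (X : CrossedProduct Γ H) {a s : H →L[ℂ] H} (ha : a ∈ X.A) (hta : 0 ≤ (X.tr.τ a).re)
    (hs : s ∈ X.Lg)
    (hss : star s = s) (hse : s * s = X.EL.E a) {η : H} {K : ℝ} (hK : 0 < K)
    (hη : ∀ x ∈ X.M, ‖x η‖ ^ 2 ≤ K * t2 X.tr x) (F : Finset Γ) (v : H) :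
    ∑ γ ∈ F, ‖⟪s (X.u γ η), v⟫_ℂ‖ ^ 2 ≤ K * (X.tr.τ a).re * ‖v‖ ^ 2 := by
  set c : Γ → ℂ := fun γ => ⟪s (X.u γ η), v⟫_ℂ with hc
  set S := ∑ γ ∈ F, ‖c γ‖ ^ 2 with hS
  have hS0 : 0 ≤ S := Finset.sum_nonneg fun _ _ => sq_nonneg _
  have hgM : s * ∑ γ ∈ F, c γ • X.u γ ∈ X.M := mul_mem (X.Lg_sub hs)
    (sum_mem fun γ _ => csmul_mem X.M _ (X.u_mem γ))
  have h1 := hη _ hgM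
  rw [t2_sg X ha hs hss hse, ← hS] at h1
  set w := (s * ∑ γ ∈ F, c γ • X.u γ) η with hw
  have h2 : ⟪w, v⟫_ℂ = (S : ℂ) := by
    have e : w = ∑ γ ∈ F, c γ • s (X.u γ η) := by
      rw [hw, mul_apply_eq_comp, sum_apply, map_sum]
      refine Finset.sum_congr rfl fun γ _ => ?_
      rw [smul_apply, map_smul]
    rw [e, sum_inner, hS]
    push_cast
    refine Finset.sum_congr rfl fun γ _ => ?_
    rw [inner_smul_left]
    exact Complex.conj_mul' (c γ)
  have h3 : S ≤ ‖w‖ * ‖v‖ := by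
    have := norm_inner_le_norm (𝕜 := ℂ) w v
    rw [h2, Complex.norm_real, Real.norm_of_nonneg hS0] at this
    exact this
  have h4 : S ^ 2 ≤ (K * (X.tr.τ a).re * ‖v‖ ^ 2) * S := by
    calc S ^ 2 ≤ (‖w‖ * ‖v‖) ^ 2 := pow_le_pow_left₀ hS0 h3 2
      _ = ‖w‖ ^ 2 * ‖v‖ ^ 2 := by ring
      _ ≤ (K * ((X.tr.τ a).re * S)) * ‖v‖ ^ 2 := mul_le_mul_of_nonneg_right h1 (sq_nonneg _)
      _ = _ := by ring
  rcases hS0.eq_or_lt with h | h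
  · rw [← h]; positivity
  · have : S * S ≤ (K * (X.tr.τ a).re * ‖v‖ ^ 2) * S := by rwa [← sq]
    exact le_of_mul_le_mul_right this h

end CDX

namespace CDX
set_option linter.unusedSectionVars false
open CD
open scoped InnerProductSpace
variable {H : Type} [NormedAddCommGroup H] [InnerProductSpace ℂ H] [CompleteSpace H]
open Filter Topology
variable {Γ : Type} [Group Γ]

theorem comm_apply {a b : H →L[ℂ] H} (h : a * b = b * a) (v : H) : a (b v) = b (a v) :=
  congrArg (fun T : H →L[ℂ] H => T v) h

theorem frame (X : CrossedProduct Γ H) {k : ℕ} (m : Fin k → (H →L[ℂ] H)) (hm : ∀ i, m i ∈ X.M)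
    (hb : ∀ x ∈ X.M, x = ∑ i, X.EL.E (x * star (m i)) * m i)
    {q : H →L[ℂ] H} (hq : IsProjIn (X.A : Set (H →L[ℂ] H)) q) (hq0 : q ≠ 0) :
    ∃ z ∈ X.M, star z = z ∧ z * z = z ∧ z * q ≠ 0 ∧ ∃ C : ℝ, 0 ≤ C ∧
      ∀ a, IsProjIn (X.A : Set (H →L[ℂ] H)) a → ∀ v, ‖a (z v)‖ ^ 2 ≤ C * (X.tr.τ a).re * ‖v‖ ^ 2 := by
  obtain ⟨η, hη0, hqη, K, hK, hη⟩ := domproj X.tr (X.A_sub hq.1) hq.2.1 hq.2.2 hq0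
  obtain ⟨C, hC0, hC⟩ := PP X.EL X.Lg_sub m hm hb
  have hn : 0 < ‖η‖ := norm_pos_iff.2 hη0
  -- the frame operator
  have hB1 : ∀ (F : Finset Γ) (v : H), ∑ γ ∈ F, ‖⟪X.u γ η, v⟫_ℂ‖ ^ 2 ≤ K * ‖v‖ ^ 2 := fun F v => by
    have := bessel X (a := 1) (s := 1) (one_mem X.A) (by rw [X.tr.unital]; simp) (one_mem X.Lg)
      (star_one _) (by rw [X.EL.fix 1 (one_mem X.Lg), one_mul]) hK hη F v
    rw [X.tr.unital] at this
    simpa using this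
  obtain ⟨k, hk⟩ := frame_op (fun γ => X.u γ η) hK.le hB1
  have hu : ∀ (γ : Γ) (v w : H), ⟪X.u γ v, w⟫_ℂ = ⟪v, X.u γ⁻¹ w⟫_ℂ := fun γ v w => by
    rw [← X.u_star, inner_star']
  have huu : ∀ (γ δ : Γ) (v : H), X.u γ (X.u δ v) = X.u (γ * δ) v := fun γ δ v => by
    rw [← X.u_mul]; rfl
  have hkcomm : ∀ δ, X.u δ * k = k * X.u δ := fun δ => by
    ext v
    apply ext_inner_right ℂ
    intro w
    rw [mul_apply_eq_comp, mul_apply_eq_comp, hu]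
    have h1 := hk v (X.u δ⁻¹ w)
    have h2 := hk (X.u δ v) w
    have h3 := (Equiv.mulLeft δ).hasSum_iff.2 h2
    refine h1.unique ?_
    convert h3 using 1
    ext γ
    simp only [Function.comp, Equiv.coe_mulLeft]
    rw [← huu, hu δ, hu δ, huu, inv_mul_cancel, X.u_one]
    rfl
  have hkre : ∀ v, HasSum (fun γ => ‖⟪X.u γ η, v⟫_ℂ‖ ^ 2) (⟪k v, v⟫_ℂ).re := fun v => by
    have h1 := Complex.hasSum_re (hk v v)
    convert h1 using 1
    ext γ
    rw [Complex.conj_mul']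
    norm_cast
  have hks : star k = k := by
    ext v
    apply ext_inner_right ℂ
    intro w
    rw [inner_star]
    have h1 := hk w v
    have h2 := h1.map (starRingEnd ℂ) Complex.continuous_conj
    rw [inner_conj_symm] at h2
    refine h2.unique ?_
    convert hk v w using 1
    ext γ
    simp only [Function.comp]
    rw [map_mul, Complex.conj_conj, mul_comm]
  set δ := ‖η‖ ^ 2 / 2 with hδ
  have hδ0 : 0 < δ := by positivity
  have hkL : k - (δ : ℂ) • 1 ∈ X.Lg.commutant :=
    sub_mem (mem_commutant_L X hkcomm) (csmul_mem _ _ (one_mem _))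
  have hds : star ((δ : ℂ) • (1 : H →L[ℂ] H)) = (δ : ℂ) • 1 := by
    rw [star_smul, star_one]
    congr 1
    exact Complex.conj_ofReal δ
  obtain ⟨w, hw, w', hw', hw0, hw'0, hww, hww', hw'w⟩ := exists_pos_neg X.Lg.commutant hkL (by
    rw [star_sub, hks, hds])
  have hwL : ∀ s ∈ X.Lg, s * w = w * s := VonNeumannAlgebra.mem_commutant_iff.1 hw
  have hkform : ∀ v, (⟪(k - (δ : ℂ) • 1) v, v⟫_ℂ).re = (⟪k v, v⟫_ℂ).re - δ * ‖v‖ ^ 2 := fun v => by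
    rw [sub_apply, smul_apply, inner_sub_left, inner_smul_left, Complex.sub_re, Complex.conj_ofReal,
      Complex.re_ofReal_mul]
    have h := inner_self_eq_norm_sq (𝕜 := ℂ) v
    have h' : (⟪(1 : H →L[ℂ] H) v, v⟫_ℂ).re = ‖v‖ ^ 2 := h
    rw [h']
  have hwη : 0 < (⟪w η, η⟫_ℂ).re := by
    have h1 := hkform η
    rw [hww, sub_apply, inner_sub_left, Complex.sub_re] at h1
    have h2 := pos_inner hw'0 η
    have h3 : ‖η‖ ^ 4 ≤ (⟪k η, η⟫_ℂ).re := by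
      have h4 := sum_le_hasSum {(1 : Γ)} (fun _ _ => sq_nonneg _) (hkre η)
      rw [Finset.sum_singleton, X.u_one] at h4
      have h5 : ‖⟪(1 : H →L[ℂ] H) η, η⟫_ℂ‖ = ‖η‖ ^ 2 := by
        have := inner_self_eq_norm_sq_to_K (𝕜 := ℂ) η
        change ‖⟪η, η⟫_ℂ‖ = _
        rw [this]; simp
      rw [h5] at h4
      calc ‖η‖ ^ 4 = (‖η‖ ^ 2) ^ 2 := by ring
        _ ≤ _ := h4
    have h6 : δ * ‖η‖ ^ 2 = ‖η‖ ^ 4 / 2 := by rw [hδ]; ring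
    have h7 : 0 < ‖η‖ ^ 4 := by positivity
    linarith
  -- the key estimate on the range of w
  have hproj : ∀ a, IsProjIn (X.A : Set (H →L[ℂ] H)) a → 0 ≤ a := fun a ha => by
    have := star_mul_self_nonneg a
    rwa [ha.2.1, ha.2.2] at this
  have hkey : ∀ a, IsProjIn (X.A : Set (H →L[ℂ] H)) a → ∀ v,
      δ * (⟪X.EL.E a (w v), w v⟫_ℂ).re ≤ K * (X.tr.τ a).re * ‖w v‖ ^ 2 := fun a ha v => by
    have haM : a ∈ X.M := X.A_sub ha.1
    have hta := tr_pos X.tr haM (hproj a ha)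
    obtain ⟨s, hs, hs0, hss, hse⟩ := exists_sqrt X.Lg (X.EL.mem a haM) (E_pos X.EL X.Lg_sub haM (hproj a ha))
    have h1 : (⟪k (s (w v)), s (w v)⟫_ℂ).re ≤ K * (X.tr.τ a).re * ‖w v‖ ^ 2 := by
      refine le_of_tendsto' (hkre (s (w v))) fun F => ?_
      have := bessel X ha.1 hta hs hss hse hK hη F (w v)
      refine le_trans (le_of_eq ?_) this
      refine Finset.sum_congr rfl fun γ _ => ?_
      have e := inner_star s (X.u γ η) (w v)
      rw [hss] at e
      rw [e]
    have h2 := hkform (s (w v))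
    have h3 : (⟪X.EL.E a (w v), w v⟫_ℂ).re = ‖s (w v)‖ ^ 2 := by
      rw [← inner_star_mul s, hss, hse]
    have h4 : 0 ≤ (⟪(k - (δ : ℂ) • 1) (s (w v)), s (w v)⟫_ℂ).re := by
      have e : (k - (δ : ℂ) • 1) (s (w v)) = w (s (w v)) := by
        rw [comm_apply (hwL s hs) v, hww, sub_apply]
        have : w' (w (s v)) = 0 := by
          rw [← mul_apply_eq_comp, hw'w]; rfl
        rw [this, sub_zero]
      rw [e]
      exact pos_inner hw0 _
    rw [h3]
    linarith
  have hn_ex : ∀ a, ∃ n ∈ X.Lg, IsProjIn (X.A : Set (H →L[ℂ] H)) a → n (w η) = 0 ∧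
      ∀ x, n x = 0 → (⟪X.EL.E a x, x⟫_ℂ).re ≤ K * (X.tr.τ a).re / δ * ‖x‖ ^ 2 := fun a => by
    by_cases ha : IsProjIn (X.A : Set (H →L[ℂ] H)) a
    swap
    · exact ⟨0, zero_mem _, fun h => absurd h ha⟩
    have haM : a ∈ X.M := X.A_sub ha.1
    set c := K * (X.tr.τ a).re / δ with hc
    have hyL : X.EL.E a ∈ X.Lg := X.EL.mem a haM
    have hys := pos_star (E_pos X.EL X.Lg_sub haM (hproj a ha))
    have hcs : star ((c : ℂ) • (1 : H →L[ℂ] H)) = (c : ℂ) • 1 := by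
      rw [star_smul, star_one]
      congr 1
      exact Complex.conj_ofReal c
    have hform : ∀ v, (⟪((c : ℂ) • (1 : H →L[ℂ] H) - X.EL.E a) v, v⟫_ℂ).re = c * ‖v‖ ^ 2 - (⟪X.EL.E a v, v⟫_ℂ).re := fun v => by
      rw [sub_apply, smul_apply, inner_sub_left, inner_smul_left, Complex.sub_re, Complex.conj_ofReal,
        Complex.re_ofReal_mul]
      have h := inner_self_eq_norm_sq (𝕜 := ℂ) v
      have h' : (⟪(1 : H →L[ℂ] H) v, v⟫_ℂ).re = ‖v‖ ^ 2 := h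
      rw [h']
    obtain ⟨p, hp, n, hnL, hp0, hn0, hpn, hpn1, hpn2⟩ := exists_pos_neg X.Lg
      (sub_mem (csmul_mem _ (c : ℂ) (one_mem _)) hyL) (by rw [star_sub, hys, hcs])
    refine ⟨n, hnL, fun _ => ⟨?_, ?_⟩⟩
    · apply cube_zero hn0
      have e : n (w η) = w (n η) := comm_apply (hwL n hnL) η
      have h1 := hkey a ha (n η)
      rw [← e] at h1
      have h2 := hform (n (w η))
      rw [hpn, sub_apply, inner_sub_left, Complex.sub_re] at h2
      have h3 : p (n (w η)) = 0 := by
        rw [← mul_apply_eq_comp, hpn1]; rfl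
      rw [h3, inner_zero_left, Complex.zero_re] at h2
      have h4 : (⟪X.EL.E a (n (w η)), n (w η)⟫_ℂ).re ≤ c * ‖n (w η)‖ ^ 2 := by
        rw [hc, div_mul_eq_mul_div, le_div_iff₀ hδ0]
        linarith
      linarith
    · intro x hx
      have h2 := hform x
      rw [hpn, sub_apply, inner_sub_left, Complex.sub_re, hx, inner_zero_left, Complex.zero_re] at h2
      have := pos_inner hp0 x
      linarith
  choose n hnL hnP using hn_ex
  let V : Submodule ℂ H := ⨅ a : {a // IsProjIn (X.A : Set (H →L[ℂ] H)) a}, LinearMap.ker (n a.1 : H →ₗ[ℂ] H)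
  have hVmem : ∀ v, v ∈ V ↔ ∀ a, IsProjIn (X.A : Set (H →L[ℂ] H)) a → n a v = 0 := fun v => by
    simp only [V, Submodule.mem_iInf, Subtype.forall]
    rfl
  have hVc : IsClosed (V : Set H) := by
    simp only [V, Submodule.coe_iInf]
    exact isClosed_iInter fun a => (n a.1).isClosed_ker
  have : CompleteSpace V := hVc.completeSpace_coe
  set z := V.starProjection with hz
  have hzL : z ∈ X.Lg := by
    apply proj_mem
    intro c hc v hv
    rw [hVmem] at hv ⊢
    intro a ha
    rw [comm_apply ((VonNeumannAlgebra.mem_commutant_iff.1 hc) (n a) (hnL a)) v, hv a ha, map_zero]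
  have hzs : star z = z := isStarProjection_starProjection.isSelfAdjoint.star_eq
  have hzz : z * z = z := isStarProjection_starProjection.isIdempotentElem
  refine ⟨z, X.Lg_sub hzL, hzs, hzz, ?_, C * K / δ, by positivity, ?_⟩
  · intro h0
    have h1 : z η = 0 := by
      rw [← hqη, ← mul_apply_eq_comp, h0]; rfl
    have h2 : z (w η) = w η := Submodule.starProjection_eq_self_iff.2
      ((hVmem _).2 fun a ha => (hnP a ha).1)
    rw [← h2, ← hzs, inner_star, h1, inner_zero_right] at hwη
    simp at hwη
  · intro a ha v
    have haM : a ∈ X.M := X.A_sub ha.1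
    have hta := tr_pos X.tr haM (hproj a ha)
    have h1 := hC a haM (z v)
    rw [ha.2.1, ha.2.2] at h1
    have h2 := (hnP a ha).2 (z v) ((hVmem _).1 (Submodule.starProjection_apply_mem V v) a ha)
    have h3 : ‖z v‖ ≤ ‖v‖ := V.norm_starProjection_apply_le v
    have h4 := pow_le_pow_left₀ (norm_nonneg _) h3 2
    calc ‖a (z v)‖ ^ 2 ≤ C * (⟪X.EL.E a (z v), z v⟫_ℂ).re := h1
      _ ≤ C * (K * (X.tr.τ a).re / δ * ‖v‖ ^ 2) := by
        apply mul_le_mul_of_nonneg_left _ hC0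
        exact h2.trans (mul_le_mul_of_nonneg_left h4 (by positivity))
      _ = _ := by ring

theorem small_piece (X : CrossedProduct Γ H) {z : H →L[ℂ] H} (hz : z ∈ X.M) (hzs : star z = z)
    (hzz : z * z = z) {a : H →L[ℂ] H} (ha : IsProjIn (X.A : Set (H →L[ℂ] H)) a) :
    (X.tr.τ (z * a)).re = t2 X.tr (z * a) := by
  have haM : a ∈ X.M := X.A_sub ha.1
  unfold t2
  have e : star (z * a) * (z * a) = a * (z * a) := by
    rw [star_mul, hzs, ha.2.1, mul_assoc, ← mul_assoc z z, hzz]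
  rw [e, X.tr.tracial a haM (z * a) (mul_mem hz haM), mul_assoc, ha.2.2]

theorem small_piece2 (X : CrossedProduct Γ H) {z : H →L[ℂ] H} (hz : z ∈ X.M) (hzs : star z = z)
    (hzz : z * z = z) {C e : ℝ} (hC0 : 0 ≤ C)
    (hC : ∀ a, IsProjIn (X.A : Set (H →L[ℂ] H)) a → ∀ v, ‖a (z v)‖ ^ 2 ≤ C * (X.tr.τ a).re * ‖v‖ ^ 2)
    {a : H →L[ℂ] H} (ha : IsProjIn (X.A : Set (H →L[ℂ] H)) a) (hae : (X.tr.τ a).re ≤ e) :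
    (X.tr.τ (z * a)).re ≤ C * e * (X.tr.τ a).re := by
  have hta : 0 ≤ (X.tr.τ a).re := by
    have := t2_nonneg X.tr (X.A_sub ha.1)
    rwa [t2, ha.2.1, ha.2.2] at this
  have haM : a ∈ X.M := X.A_sub ha.1
  rw [small_piece X hz hzs hzz ha]
  have hn1 : ‖a * z‖ ≤ Real.sqrt (C * (X.tr.τ a).re) := by
    apply ContinuousLinearMap.opNorm_le_bound _ (Real.sqrt_nonneg _)
    intro v
    have := hC a ha v
    have h4 := Real.le_sqrt_of_sq_le this
    rw [Real.sqrt_mul (by positivity), Real.sqrt_sq (norm_nonneg v)] at h4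
    exact h4
  have hn2 : ‖z * a‖ ^ 2 ≤ C * (X.tr.τ a).re := by
    rw [← norm_star, star_mul, hzs, ha.2.1]
    calc ‖a * z‖ ^ 2 ≤ (Real.sqrt (C * (X.tr.τ a).re)) ^ 2 := pow_le_pow_left₀ (norm_nonneg _) hn1 2
      _ = _ := Real.sq_sqrt (by positivity)
  have h5 := t2_mul_le' X.tr (mul_mem hz haM) haM
  rw [mul_assoc, ha.2.2] at h5
  have h6 : t2 X.tr a = (X.tr.τ a).re := by rw [t2, ha.2.1, ha.2.2]
  rw [h6] at h5
  calc _ ≤ _ := h5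
    _ ≤ (C * (X.tr.τ a).re) * (X.tr.τ a).re := mul_le_mul_of_nonneg_right hn2 hta
    _ ≤ (C * e) * (X.tr.τ a).re := by
      apply mul_le_mul_of_nonneg_right _ hta
      exact mul_le_mul_of_nonneg_left hae hC0

end CDX

namespace CDX
set_option linter.unusedSectionVars false
open CD
open scoped InnerProductSpace
variable {H : Type} [NormedAddCommGroup H] [InnerProductSpace ℂ H] [CompleteSpace H]
open Filter Topology

variable {A : VonNeumannAlgebra H}

inductive Part (A : VonNeumannAlgebra H) (φ : (H →L[ℂ] H) → ℝ) (ε : ℝ) : (H →L[ℂ] H) → Prop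
  | zero : Part A φ ε 0
  | cons (a c : H →L[ℂ] H) : IsProjIn (A : Set (H →L[ℂ] H)) a → φ a ≤ ε → Part A φ ε c → a * c = 0 →
      Part A φ ε (a + c)

theorem proj_zero : IsProjIn (A : Set (H →L[ℂ] H)) 0 := ⟨zero_mem A, star_zero _, mul_zero _⟩
theorem proj_one : IsProjIn (A : Set (H →L[ℂ] H)) 1 := ⟨one_mem A, star_one _, mul_one _⟩

theorem proj_mul (hab : IsAbelianSet (A : Set (H →L[ℂ] H))) {a b : H →L[ℂ] H}
    (ha : IsProjIn (A : Set (H →L[ℂ] H)) a) (hb : IsProjIn (A : Set (H →L[ℂ] H)) b) :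
    IsProjIn (A : Set (H →L[ℂ] H)) (a * b) := by
  have h := hab a ha.1 b hb.1
  refine ⟨mul_mem ha.1 hb.1, ?_, ?_⟩
  · rw [star_mul, ha.2.1, hb.2.1, h]
  · rw [mul_assoc, ← mul_assoc b a b, ← h, mul_assoc a b b, hb.2.2, ← mul_assoc, ha.2.2]

theorem proj_add (hab : IsAbelianSet (A : Set (H →L[ℂ] H))) {a b : H →L[ℂ] H}
    (ha : IsProjIn (A : Set (H →L[ℂ] H)) a) (hb : IsProjIn (A : Set (H →L[ℂ] H)) b) (h0 : a * b = 0) :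
    IsProjIn (A : Set (H →L[ℂ] H)) (a + b) := by
  have h := hab a ha.1 b hb.1
  refine ⟨add_mem ha.1 hb.1, by rw [star_add, ha.2.1, hb.2.1], ?_⟩
  rw [add_mul, mul_add, mul_add, ha.2.2, hb.2.2, h0, ← h, h0]
  abel

theorem proj_sub (hab : IsAbelianSet (A : Set (H →L[ℂ] H))) {a b : H →L[ℂ] H}
    (ha : IsProjIn (A : Set (H →L[ℂ] H)) a) (hb : IsProjIn (A : Set (H →L[ℂ] H)) b) (h0 : a * b = a) :
    IsProjIn (A : Set (H →L[ℂ] H)) (b - a) := by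
  have h := hab a ha.1 b hb.1
  refine ⟨sub_mem hb.1 ha.1, by rw [star_sub, ha.2.1, hb.2.1], ?_⟩
  rw [sub_mul, mul_sub, mul_sub, ha.2.2, hb.2.2, h0, ← h, h0]
  abel

theorem proj_nonneg {a : H →L[ℂ] H} (ha : IsProjIn (A : Set (H →L[ℂ] H)) a) : 0 ≤ a := by
  have := star_mul_self_nonneg a
  rwa [ha.2.1, ha.2.2] at this

theorem proj_le (hab : IsAbelianSet (A : Set (H →L[ℂ] H))) {a b : H →L[ℂ] H}
    (ha : IsProjIn (A : Set (H →L[ℂ] H)) a) (hb : IsProjIn (A : Set (H →L[ℂ] H)) b) (h0 : a * b = a) :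
    a ≤ b := sub_nonneg.1 (proj_nonneg (proj_sub hab ha hb h0))

theorem proj_inner {a : H →L[ℂ] H} (ha : IsProjIn (A : Set (H →L[ℂ] H)) a) (v : H) :
    (⟪a v, v⟫_ℂ).re = ‖a v‖ ^ 2 := by
  rw [← inner_star_mul, ha.2.1, ha.2.2]

theorem proj_norm {a : H →L[ℂ] H} (ha : IsProjIn (A : Set (H →L[ℂ] H)) a) (v : H) :
    ‖a v‖ ≤ ‖v‖ := by
  have h1 := proj_inner ha v
  have h2 := (Complex.re_le_norm ⟪a v, v⟫_ℂ).trans (norm_inner_le_norm _ _)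
  rw [h1, sq] at h2
  rcases (norm_nonneg (a v)).eq_or_lt with h | h
  · rw [← h]; exact norm_nonneg v
  · exact le_of_mul_le_mul_left h2 h

theorem Part.proj (hab : IsAbelianSet (A : Set (H →L[ℂ] H))) {φ : (H →L[ℂ] H) → ℝ} {ε : ℝ}
    {c : H →L[ℂ] H} (h : Part A φ ε c) : IsProjIn (A : Set (H →L[ℂ] H)) c := by
  induction h with
  | zero => exact proj_zero
  | cons a c ha _ _ h0 ih => exact proj_add hab ha ih h0

theorem Part.single {φ : (H →L[ℂ] H) → ℝ} {ε : ℝ}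
    {c : H →L[ℂ] H} (hc : IsProjIn (A : Set (H →L[ℂ] H)) c) (h : φ c ≤ ε) : Part A φ ε c := by
  have := Part.cons c 0 hc h Part.zero (mul_zero c)
  rwa [add_zero] at this

theorem Part.add (hab : IsAbelianSet (A : Set (H →L[ℂ] H))) {φ : (H →L[ℂ] H) → ℝ} {ε : ℝ}
    {c d : H →L[ℂ] H} (h : Part A φ ε c) (hd : Part A φ ε d) (h0 : c * d = 0) : Part A φ ε (c + d) := by
  induction h with
  | zero => rwa [zero_add]
  | cons a c ha hφ hc hac ih =>
    have hcP := hc.proj hab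
    have hca : c * a = 0 := by rw [hab c hcP.1 a ha.1, hac]
    have h1 : a * d = 0 := by
      have : a * ((a + c) * d) = a * d := by rw [← mul_assoc, mul_add, ha.2.2, hac, add_zero]
      rw [← this, h0, mul_zero]
    have h2 : c * d = 0 := by
      have : c * ((a + c) * d) = c * d := by rw [← mul_assoc, mul_add, hcP.2.2, hca, zero_add]
      rw [← this, h0, mul_zero]
    rw [add_assoc]
    exact Part.cons a (c + d) ha hφ (ih h2) (by rw [mul_add, hac, h1, add_zero])

theorem proj_dec (hab : IsAbelianSet (A : Set (H →L[ℂ] H))) (c : ℕ → H →L[ℂ] H)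
    (hP : ∀ n, IsProjIn (A : Set (H →L[ℂ] H)) (c n)) (hd : ∀ n, c (n + 1) * c n = c (n + 1)) :
    ∃ F, IsProjIn (A : Set (H →L[ℂ] H)) F ∧ (∀ n, F * c n = F) ∧
      ∀ v, Tendsto (fun n => c n v) atTop (𝓝 (F v)) := by
  have hanti : Antitone c := antitone_nat_of_succ_le fun n => proj_le hab (hP _) (hP n) (hd n)
  have hmn : ∀ n m, n ≤ m → c m * c n = c m := fun n m h => by
    induction m, h using Nat.le_induction with
    | base => exact (hP n).2.2
    | succ m _ ih => rw [← hd m, mul_assoc, ih]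
  obtain ⟨F, hFA, hF0, hFle, hFt⟩ := dec_limit (M := A) c (fun n => (hP n).1) (fun n => proj_nonneg (hP n))
    (fun n => proj_le hab (hP n) proj_one (mul_one _)) hanti
  have hFs := pos_star hF0
  refine ⟨F, ⟨hFA, hFs, ?_⟩, fun n => ?_, hFt⟩
  · ext v
    apply ext_inner_right ℂ
    intro w
    have e := inner_star F (F v) w
    rw [hFs] at e
    rw [mul_apply_eq_comp, e]
    have h1 : Tendsto (fun n => ⟪c n v, c n w⟫_ℂ) atTop (𝓝 ⟪F v, F w⟫_ℂ) := (hFt v).inner (hFt w)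
    have h2 : Tendsto (fun n => ⟪c n v, w⟫_ℂ) atTop (𝓝 ⟪F v, w⟫_ℂ) := (hFt v).inner tendsto_const_nhds
    refine tendsto_nhds_unique h1 (h2.congr fun n => ?_)
    have e2 := inner_star (c n) (c n v) w
    rw [(hP n).2.1, ← mul_apply_eq_comp, (hP n).2.2] at e2
    exact e2
  · ext v
    refine tendsto_nhds_unique (hFt (c n v)) ((hFt v).congr' ?_)
    filter_upwards [eventually_ge_atTop n] with m hm
    rw [← mul_apply_eq_comp, hmn n m hm]

variable {M : VonNeumannAlgebra H} (tr : TraceOn H (M : Set (H →L[ℂ] H)))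

theorem tr_proj (hAM : (A : Set (H →L[ℂ] H)) ⊆ M) {a : H →L[ℂ] H}
    (ha : IsProjIn (A : Set (H →L[ℂ] H)) a) : 0 ≤ (tr.τ a).re :=
  tr_pos tr (hAM ha.1) (proj_nonneg ha)

/-- Lemma N. -/
theorem lemmaN (tr : TraceOn H (M : Set (H →L[ℂ] H))) (hab : IsAbelianSet (A : Set (H →L[ℂ] H))) (hAM : (A : Set (H →L[ℂ] H)) ⊆ M)
    {p : H →L[ℂ] H} (hp : IsProjIn (A : Set (H →L[ℂ] H)) p)
    (hmin : ∀ c, IsProjIn (A : Set (H →L[ℂ] H)) c → c ≠ 0 → c * p = c →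
      ∃ r, IsProjIn (A : Set (H →L[ℂ] H)) r ∧ r * c = r ∧ r ≠ 0 ∧ r ≠ c)
    (ξ : H) {ε : ℝ} (hε : 0 < ε) : Part A (fun a => ‖a ξ‖ ^ 2) ε p := by
  by_contra hcon
  set J := Part A (fun a => ‖a ξ‖ ^ 2) ε with hJ
  let S : Type := {c // IsProjIn (A : Set (H →L[ℂ] H)) c ∧ ¬ J c}
  have hstep : ∀ (c : S) (n : ℕ), ∃ d : S, d.1 * c.1 = d.1 ∧
      ∀ c' : S, c'.1 * c.1 = c'.1 → (tr.τ d.1).re ≤ (tr.τ c'.1).re + 1 / ((n : ℝ) + 1) := by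
    intro c n
    have hpos : (0 : ℝ) < 1 / ((n : ℝ) + 1) := by positivity
    let T : Set ℝ := (fun c' : S => (tr.τ c'.1).re) '' {c' | c'.1 * c.1 = c'.1}
    have hT : BddBelow T := ⟨0, by
      rintro _ ⟨c', _, rfl⟩
      exact tr_proj tr hAM c'.2.1⟩
    obtain ⟨_, ⟨d, hd, rfl⟩, h⟩ := exists_lt_of_csInf_lt (s := T) ⟨_, c, c.2.1.2.2, rfl⟩
      (b := sInf T + 1 / ((n : ℝ) + 1)) (by linarith)
    refine ⟨d, hd, fun c' hc' => ?_⟩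
    have := csInf_le hT ⟨c', hc', rfl⟩
    simp only at this h
    linarith
  choose D hD1 hD2 using hstep
  let c' : ℕ → S := fun n => Nat.rec ⟨p, hp, hcon⟩ (fun n c => D c n) n
  have hc0 : (c' 0).1 = p := rfl
  have hcs : ∀ n, c' (n + 1) = D (c' n) n := fun n => rfl
  obtain ⟨F, hFP, hFc, hFt⟩ := proj_dec hab (fun n => (c' n).1) (fun n => (c' n).2.1) (fun n => by
    simp only [hcs]; exact hD1 _ _)
  have hFJ : ¬ J F := by
    intro hF
    have h1 : Tendsto (fun n => ‖((c' n).1 - F) ξ‖ ^ 2) atTop (𝓝 0) := by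
      have := ((hFt ξ).sub_const (F ξ)).norm.pow 2
      simpa using this
    obtain ⟨n, hn⟩ := (h1.eventually (gt_mem_nhds hε)).exists
    apply (c' n).2.2
    have hs := proj_sub hab hFP (c' n).2.1 (hFc n)
    have h2 := Part.add hab hF (Part.single (φ := fun a => ‖a ξ‖ ^ 2) hs hn.le) (by
      rw [mul_sub, hFc n, hFP.2.2, sub_self])
    rwa [add_sub_cancel] at h2
  have hFmin : ∀ d, IsProjIn (A : Set (H →L[ℂ] H)) d → d * F = d → ¬ J d → d = F := by
    intro d hd hdF hdJ
    have h1 : ∀ n : ℕ, (tr.τ F).re ≤ (tr.τ d).re + 1 / ((n : ℝ) + 1) := fun n => by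
      have h2 := hD2 (c' n) n ⟨d, hd, hdJ⟩ (by
        show d * (c' n).1 = d
        rw [← hdF, mul_assoc, hFc n])
      have h3 := tr_mono tr (hAM hFP.1) (hAM (c' (n+1)).2.1.1) (proj_le hab hFP (c' (n+1)).2.1 (hFc (n+1)))
      rw [hcs n] at h3
      exact h3.trans h2
    have h2 : (tr.τ F).re ≤ (tr.τ d).re := by
      have := (tendsto_one_div_add_atTop_nhds_zero_nat (𝕜 := ℝ)).const_add (tr.τ d).re
      rw [add_zero] at this
      exact ge_of_tendsto' this h1
    have hs := proj_sub hab hd hFP hdF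
    have := tr_pos_zero tr (hAM hs.1) (proj_nonneg hs) (by rw [map_sub, Complex.sub_re]; linarith)
    exact (sub_eq_zero.1 this).symm
  have hF0 : F ≠ 0 := fun h => hFJ (h ▸ Part.zero)
  have hFp : F * p = F := hFc 0
  obtain ⟨r, hr, hrF, hr0, hrne⟩ := hmin F hFP hF0 hFp
  have hJr : J r := by
    by_contra h
    exact hrne (hFmin r hr hrF h)
  have hs := proj_sub hab hr hFP hrF
  have hFr : r * (F - r) = 0 := by rw [mul_sub, hrF, hr.2.2, sub_self]
  have hJs : J (F - r) := by
    by_contra h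
    have := hFmin (F - r) hs (by rw [sub_mul, hFP.2.2, hrF]) h
    exact hr0 (sub_eq_self.1 this)
  apply hFJ
  have := Part.add hab hJr hJs hFr
  rwa [add_sub_cancel] at this

theorem Part.split (hab : IsAbelianSet (A : Set (H →L[ℂ] H))) (hAM : (A : Set (H →L[ℂ] H)) ⊆ M)
    {ξ : H} {ε θ : ℝ} (hε : 0 ≤ ε) {p : H →L[ℂ] H} (h : Part A (fun a => ‖a ξ‖ ^ 2) ε p) :
    ∃ r s, p = r + s ∧ r * s = 0 ∧ IsProjIn (A : Set (H →L[ℂ] H)) s ∧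
      Part A (fun a => (tr.τ a).re) θ r ∧ ‖s ξ‖ ^ 2 * θ ≤ ε * (tr.τ s).re := by
  induction h with
  | zero => exact ⟨0, 0, by simp, by simp, proj_zero, Part.zero, by simp⟩
  | cons a c ha hφ hc hac ih =>
    obtain ⟨r, s, e, hrs, hs, hr, hb⟩ := ih
    have hrP := hr.proj hab
    have hcP := hc.proj hab
    have hsr : s * r = 0 := by rw [hab s hs.1 r hrP.1, hrs]
    have har : a * r = 0 := by
      have : r = c * r := by rw [e, add_mul, hrP.2.2, hsr, add_zero]
      rw [this, ← mul_assoc, hac, zero_mul]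
    have has : a * s = 0 := by
      have : s = c * s := by rw [e, add_mul, hs.2.2, hrs, zero_add]
      rw [this, ← mul_assoc, hac, zero_mul]
    by_cases ht : (tr.τ a).re ≤ θ
    · refine ⟨a + r, s, by rw [e, add_assoc], by rw [add_mul, has, hrs, add_zero], hs,
        Part.cons a r ha ht hr har, hb⟩
    · push Not at ht
      refine ⟨r, a + s, by rw [e]; abel, ?_, proj_add hab ha hs has, hr, ?_⟩
      · rw [mul_add, hrs, hab r hrP.1 a ha.1, har, add_zero]
      · have h1 : ‖(a + s) ξ‖ ^ 2 = ‖a ξ‖ ^ 2 + ‖s ξ‖ ^ 2 := by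
          rw [← proj_inner (proj_add hab ha hs has), ← proj_inner ha, ← proj_inner hs, add_apply,
            inner_add_left, Complex.add_re]
        rw [h1, map_add, Complex.add_re]
        have h2 : ‖a ξ‖ ^ 2 * θ ≤ ε * (tr.τ a).re := by
          calc ‖a ξ‖ ^ 2 * θ ≤ ‖a ξ‖ ^ 2 * (tr.τ a).re := mul_le_mul_of_nonneg_left ht.le (sq_nonneg _)
            _ ≤ _ := mul_le_mul_of_nonneg_right hφ (tr_proj tr hAM ha)
        linarith

end CDX

namespace CDX
set_option linter.unusedSectionVars false
open CD
open scoped InnerProductSpace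
variable {H : Type} [NormedAddCommGroup H] [InnerProductSpace ℂ H] [CompleteSpace H]
open Filter Topology
variable {A : VonNeumannAlgebra H}
variable {M : VonNeumannAlgebra H} (tr : TraceOn H (M : Set (H →L[ℂ] H)))
variable {Γ : Type} [Group Γ]

theorem Part.compress (hab : IsAbelianSet (A : Set (H →L[ℂ] H))) (hAM : (A : Set (H →L[ℂ] H)) ⊆ M)
    {θ : ℝ} {c q : H →L[ℂ] H} (hq : IsProjIn (A : Set (H →L[ℂ] H)) q)
    (h : Part A (fun a => (tr.τ a).re) θ c) : Part A (fun a => (tr.τ a).re) θ (q * c) := by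
  induction h with
  | zero => rw [mul_zero]; exact Part.zero
  | cons a c ha hφ hc hac ih =>
    rw [mul_add]
    have hqa := proj_mul hab hq ha
    refine Part.cons _ _ hqa ?_ ih ?_
    · refine le_trans (tr_mono tr (hAM hqa.1) (hAM ha.1) (proj_le hab hqa ha ?_)) hφ
      rw [mul_assoc, ha.2.2]
    · rw [hab q hq.1 a ha.1, mul_assoc, ← mul_assoc q q, hq.2.2, ← mul_assoc, hab a ha.1 q hq.1,
        mul_assoc, hac, mul_zero]

theorem Part.mono {φ : (H →L[ℂ] H) → ℝ} {ε ε' : ℝ} (he : ε ≤ ε') {c : H →L[ℂ] H}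
    (h : Part A φ ε c) : Part A φ ε' c := by
  induction h with
  | zero => exact Part.zero
  | cons a c ha hφ hc hac ih => exact Part.cons a c ha (hφ.trans he) ih hac

theorem lemmaQ (tr : TraceOn H (M : Set (H →L[ℂ] H)))
    (hab : IsAbelianSet (A : Set (H →L[ℂ] H))) (hAM : (A : Set (H →L[ℂ] H)) ⊆ M)
    {p : H →L[ℂ] H} (hp : IsProjIn (A : Set (H →L[ℂ] H)) p) (hp0 : p ≠ 0)
    (hmin : ∀ c, IsProjIn (A : Set (H →L[ℂ] H)) c → c ≠ 0 → c * p = c →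
      ∃ r, IsProjIn (A : Set (H →L[ℂ] H)) r ∧ r * c = r ∧ r ≠ 0 ∧ r ≠ c) :
    ∃ F, IsProjIn (A : Set (H →L[ℂ] H)) F ∧ F ≠ 0 ∧ F * p = F ∧
      ∀ ε : ℝ, 0 < ε → Part A (fun a => (tr.τ a).re) ε F := by
  obtain ⟨v, hv⟩ : ∃ v, p v ≠ 0 := by
    by_contra h
    push Not at h
    exact hp0 (ContinuousLinearMap.ext h)
  set ξ := p v with hξ
  have hpξ : p ξ = ξ := by rw [hξ, ← mul_apply_eq_comp, hp.2.2]
  have hn : 0 < ‖ξ‖ := norm_pos_iff.2 hv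
  have hex : ∀ n : ℕ, ∃ r, IsProjIn (A : Set (H →L[ℂ] H)) r ∧
      Part A (fun a => (tr.τ a).re) ((1 / 2) ^ n) r ∧ r * p = r ∧ ‖ξ - r ξ‖ ≤ ‖ξ‖ / 4 * (1 / 2) ^ n := by
    intro n
    set θ : ℝ := (1 / 2) ^ n with hθ
    have hθ0 : 0 < θ := by positivity
    set b : ℝ := ‖ξ‖ / 4 * θ with hb
    have hb0 : 0 < b := by positivity
    have hε : 0 < θ * b ^ 2 := by positivity
    obtain ⟨r, s, e, hrs, hs, hr, hbd⟩ := Part.split tr hab hAM (θ := θ) hε.le (lemmaN tr hab hAM hp hmin ξ hε)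
    have hrP := hr.proj hab
    refine ⟨r, hrP, hr, by rw [e, mul_add, hrP.2.2, hrs, add_zero], ?_⟩
    have e1 : ξ - r ξ = s ξ := by
      have h : r ξ + s ξ = ξ := by rw [← add_apply, ← e, hpξ]
      exact sub_eq_iff_eq_add'.2 h.symm
    rw [e1]
    have h1 : (tr.τ s).re ≤ 1 := by
      have := tr_mono tr (hAM hs.1) (one_mem M) (proj_le hab hs proj_one (mul_one _))
      rwa [tr.unital, Complex.one_re] at this
    have h2 : θ * ‖s ξ‖ ^ 2 ≤ θ * b ^ 2 := by nlinarith
    exact (pow_le_pow_iff_left₀ (norm_nonneg _) hb0.le two_ne_zero).1 (le_of_mul_le_mul_left h2 hθ0)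
  choose r hrP hr hrp hrξ using hex
  let Q : ℕ → (H →L[ℂ] H) := fun n => Nat.rec p (fun n c => r n * c) n
  have hQ0 : Q 0 = p := rfl
  have hQs : ∀ n, Q (n + 1) = r n * Q n := fun n => rfl
  have hQP : ∀ n, IsProjIn (A : Set (H →L[ℂ] H)) (Q n) := fun n => by
    induction n with
    | zero => exact hp
    | succ n ih => rw [hQs]; exact proj_mul hab (hrP n) ih
  obtain ⟨F, hF, hFQ, hFt⟩ := proj_dec hab Q hQP (fun n => by
    rw [hQs, mul_assoc, (hQP n).2.2])
  have hbound : ∀ n, ‖ξ - Q n ξ‖ ≤ ‖ξ‖ / 2 * (1 - (1 / 2) ^ n) := fun n => by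
    induction n with
    | zero => rw [hQ0, hpξ]; simp
    | succ n ih =>
      have e : ξ - Q (n + 1) ξ = (ξ - r n ξ) + r n (ξ - Q n ξ) := by
        rw [hQs, mul_apply_eq_comp, map_sub]; abel
      rw [e]
      have h1 := norm_add_le (ξ - r n ξ) (r n (ξ - Q n ξ))
      have h2 := proj_norm (hrP n) (ξ - Q n ξ)
      have h3 := hrξ n
      rw [pow_succ]
      linarith
  have hFξ : ‖ξ - F ξ‖ ≤ ‖ξ‖ / 2 := by
    refine le_of_tendsto' ((hFt ξ).const_sub ξ).norm fun n => (hbound n).trans ?_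
    have : (0 : ℝ) < (1 / 2) ^ n := by positivity
    nlinarith
  have hFr : ∀ n, F * r n = F := fun n => by
    have := hFQ (n + 1)
    rw [hQs] at this
    rw [← this, mul_assoc, hab _ (mul_mem (hrP n).1 (hQP n).1) _ (hrP n).1, ← mul_assoc (r n), (hrP n).2.2]
  refine ⟨F, hF, ?_, hFQ 0, fun ε hε => ?_⟩
  · rintro rfl
    simp at hFξ
    linarith
  · obtain ⟨n, hn⟩ := exists_pow_lt_of_lt_one hε (by norm_num : (1 / 2 : ℝ) < 1)
    have := Part.compress tr hab hAM hF (hr n)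
    rw [hFr] at this
    exact this.mono hn.le

theorem small_partition (X : CrossedProduct Γ H) (hab : IsAbelianSet (X.A : Set (H →L[ℂ] H)))
    {z q : H →L[ℂ] H} (hz : z ∈ X.M) (hzs : star z = z)
    (hzz : z * z = z) {C : ℝ} (hC0 : 0 ≤ C)
    (hC : ∀ a, IsProjIn (X.A : Set (H →L[ℂ] H)) a → ∀ v, ‖a (z v)‖ ^ 2 ≤ C * (X.tr.τ a).re * ‖v‖ ^ 2)
    (hq : IsProjIn (X.A : Set (H →L[ℂ] H)) q)
    (hpart : ∀ ε : ℝ, 0 < ε → Part X.A (fun a => (X.tr.τ a).re) ε q) :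
    z * q = 0 := by
  have hqM : q ∈ X.M := X.A_sub hq.1
  have key : ∀ e c, Part X.A (fun a => (X.tr.τ a).re) e c → (X.tr.τ (z * c)).re ≤ C * e * (X.tr.τ c).re := by
    intro e c h
    induction h with
    | zero => simp
    | cons a c ha hφ hc hac ih =>
      have := small_piece2 X hz hzs hzz hC0 hC ha hφ
      rw [mul_add, map_add, map_add, Complex.add_re, Complex.add_re]
      linarith
  apply t2_zero X.tr (mul_mem hz hqM)
  apply le_antisymm _ (t2_nonneg X.tr (mul_mem hz hqM))
  apply le_of_forall_pos_le_add
  intro ε hε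
  have hq0 := tr_proj X.tr X.A_sub hq
  set e := ε / ((C + 1) * ((X.tr.τ q).re + 1)) with he
  have he0 : 0 < e := by rw [he]; positivity
  have h1 := key e q (hpart e he0)
  rw [← small_piece X hz hzs hzz hq, zero_add]
  have h7 : (C + 1) * ((X.tr.τ q).re + 1) * e = ε := by
    rw [he]; field_simp
  nlinarith [mul_nonneg hC0 he0.le, mul_nonneg hC0 hq0, mul_nonneg he0.le hq0]

theorem atomic (X : CrossedProduct Γ H) (hab : IsAbelianSet (X.A : Set (H →L[ℂ] H)))
    {k : ℕ} (m : Fin k → (H →L[ℂ] H)) (hm : ∀ i, m i ∈ X.M)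
    (hb : ∀ x ∈ X.M, x = ∑ i, X.EL.E (x * star (m i)) * m i) :
    IsCompletelyAtomic (X.A : Set (H →L[ℂ] H)) := by
  intro p hp hp0
  by_contra hcon
  push Not at hcon
  obtain ⟨F, hF, hF0, -, hFP⟩ := lemmaQ X.tr hab X.A_sub hp hp0 hcon
  obtain ⟨z, hz, hzs, hzz, hzF, C, hC0, hC⟩ := frame X m hm hb hF hF0
  exact hzF (small_partition X hab hz hzs hzz hC0 hC hF hFP)

end CDX

namespace CDX
set_option linter.unusedSectionVars false
open CD
open scoped InnerProductSpace
variable {H : Type} [NormedAddCommGroup H] [InnerProductSpace ℂ H] [CompleteSpace H]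
open Filter Topology
variable {A : VonNeumannAlgebra H}
variable {M : VonNeumannAlgebra H} (tr : TraceOn H (M : Set (H →L[ℂ] H)))
variable {Γ : Type} [Group Γ]

/-- For a minimal projection `e` and a positive orthogonal pair, one of them is killed by `e`. -/
theorem min_kill (hab : IsAbelianSet (A : Set (H →L[ℂ] H)))
    {e : H →L[ℂ] H} (he : IsProjIn (A : Set (H →L[ℂ] H)) e)
    (hmin : ∀ r, IsProjIn (A : Set (H →L[ℂ] H)) r → r * e = r → r = 0 ∨ r = e)
    {a b : H →L[ℂ] H} (ha : a ∈ A) (hb : b ∈ A) (h0 : a * b = 0) : a * e = 0 ∨ b * e = 0 := by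
  let V : Submodule ℂ H := LinearMap.ker (a : H →ₗ[ℂ] H)
  have hVmem : ∀ v, v ∈ V ↔ a v = 0 := fun v => Iff.rfl
  have hVc : IsClosed (V : Set H) := a.isClosed_ker
  have : CompleteSpace V := hVc.completeSpace_coe
  set z := V.starProjection with hz
  have hzA : z ∈ A := by
    apply proj_mem
    intro c hc v hv
    rw [hVmem] at hv ⊢
    rw [comm_apply ((VonNeumannAlgebra.mem_commutant_iff.1 hc) a ha) v, hv, map_zero]
  have hzs : star z = z := isStarProjection_starProjection.isSelfAdjoint.star_eq
  have hzz : z * z = z := isStarProjection_starProjection.isIdempotentElem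
  have haz : a * z = 0 := by
    ext v
    exact (hVmem _).1 (Submodule.starProjection_apply_mem V v)
  have hzb : z * b = b := by
    ext v
    apply Submodule.starProjection_eq_self_iff.2
    rw [hVmem]
    exact congrArg (fun T : H →L[ℂ] H => T v) h0
  have hzP : IsProjIn (A : Set (H →L[ℂ] H)) z := ⟨hzA, hzs, hzz⟩
  rcases hmin (z * e) (proj_mul hab hzP he) (by rw [mul_assoc, he.2.2]) with h | h
  · right
    rw [← hzb, hab z hzA b hb, mul_assoc, h, mul_zero]
  · left
    rw [← h, ← mul_assoc, haz, zero_mul]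

theorem min_sa (tr : TraceOn H (M : Set (H →L[ℂ] H))) (hab : IsAbelianSet (A : Set (H →L[ℂ] H)))
    (hAM : (A : Set (H →L[ℂ] H)) ⊆ M)
    {e : H →L[ℂ] H} (he : IsProjIn (A : Set (H →L[ℂ] H)) e) (he0 : e ≠ 0)
    (hmin : ∀ r, IsProjIn (A : Set (H →L[ℂ] H)) r → r * e = r → r = 0 ∨ r = e)
    {x : H →L[ℂ] H} (hx : x ∈ A) (hxs : star x = x) : ∃ t : ℝ, x * e = (t : ℂ) • e := by
  have hte : 0 < (tr.τ e).re := by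
    by_contra h
    exact he0 (tr_pos_zero tr (hAM he.1) (proj_nonneg he) (not_lt.1 h))
  set t : ℝ := (tr.τ (x * e)).re / (tr.τ e).re with ht
  refine ⟨t, ?_⟩
  have hcs : star ((t : ℂ) • (1 : H →L[ℂ] H)) = (t : ℂ) • 1 := by
    rw [star_smul, star_one]
    congr 1
    exact Complex.conj_ofReal t
  obtain ⟨a, ha, b, hb, ha0, hb0, hy, hab1, hab2⟩ := exists_pos_neg A
    (sub_mem hx (csmul_mem A (t : ℂ) (one_mem A))) (by rw [star_sub, hxs, hcs])
  have e1 : x * e - (t : ℂ) • e = a * e - b * e := by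
    rw [← sub_mul, ← hy, sub_mul, smul_mul_assoc, one_mul]
  have htr : (tr.τ (x * e - (t : ℂ) • e)).re = 0 := by
    rw [map_sub, map_smul, Complex.sub_re, smul_eq_mul, Complex.re_ofReal_mul, ht]
    field_simp
    simp
  have hpos : ∀ c, c ∈ A → 0 ≤ c → 0 ≤ c * e := fun c hc hc0 => by
    have : c * e = star e * c * e := by
      rw [he.2.1, hab e he.1 c hc, mul_assoc, he.2.2]
    rw [this]
    exact star_left_conjugate_nonneg hc0 e
  have hMe : ∀ c, c ∈ A → c * e ∈ M := fun c hc => mul_mem (hAM hc) (hAM he.1)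
  rw [← sub_eq_zero]
  rw [e1] at htr ⊢
  rcases min_kill hab he hmin ha hb hab1 with h | h
  · rw [h, zero_sub, map_neg, Complex.neg_re] at htr
    rw [h, tr_pos_zero tr (hMe b hb) (hpos b hb hb0) (by linarith), sub_zero]
  · rw [h, sub_zero] at htr
    rw [h, tr_pos_zero tr (hMe a ha) (hpos a ha ha0) (by linarith), sub_zero]

theorem min_all (tr : TraceOn H (M : Set (H →L[ℂ] H))) (hab : IsAbelianSet (A : Set (H →L[ℂ] H)))
    (hAM : (A : Set (H →L[ℂ] H)) ⊆ M)
    {e : H →L[ℂ] H} (he : IsProjIn (A : Set (H →L[ℂ] H)) e) (he0 : e ≠ 0)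
    (hmin : ∀ r, IsProjIn (A : Set (H →L[ℂ] H)) r → r * e = r → r = 0 ∨ r = e)
    {x : H →L[ℂ] H} (hx : x ∈ A) : ∃ c : ℂ, x * e = c • e := by
  obtain ⟨s, hs⟩ := min_sa tr hab hAM he he0 hmin (x := x + star x) (add_mem hx (star_mem hx))
    (by rw [star_add, star_star, add_comm])
  obtain ⟨t, ht⟩ := min_sa tr hab hAM he he0 hmin (x := Complex.I • (x - star x))
    (csmul_mem A _ (sub_mem hx (star_mem hx)))
    (by rw [star_smul, star_sub, star_star, Complex.star_def, Complex.conj_I, neg_smul, ← smul_neg, neg_sub])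
  refine ⟨(s - Complex.I * t) / 2, ?_⟩
  have e1 : x = (1 / 2 : ℂ) • ((x + star x) - Complex.I • (Complex.I • (x - star x))) := by
    rw [smul_smul, Complex.I_mul_I, neg_one_smul, sub_neg_eq_add, add_add_sub_cancel, ← two_smul ℂ x, smul_smul]
    norm_num
  conv_lhs => rw [e1]
  rw [smul_mul_assoc, sub_mul, hs, smul_mul_assoc, ht, smul_smul, ← sub_smul, smul_smul]
  congr 1
  ring

theorem transitive (X : CrossedProduct Γ H) (hab : IsAbelianSet (X.A : Set (H →L[ℂ] H)))
    (hat : IsCompletelyAtomic (X.A : Set (H →L[ℂ] H))) (herg : IsErgodic X) :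
    IsTransitiveOn X (X.A : Set (H →L[ℂ] H)) := by
  have h10 : (1 : H →L[ℂ] H) ≠ 0 := fun h => by
    have := X.tr.unital
    rw [h, map_zero] at this
    exact zero_ne_one this
  obtain ⟨e, he, he0, -, hmin⟩ := hat 1 proj_one h10
  have huu : ∀ γ, star (X.u γ) * X.u γ = 1 := fun γ => by
    rw [X.u_star, X.u_mul, inv_mul_cancel, X.u_one]
  have hσ1 : ∀ x, X.σ 1 x = x := fun x => by
    simp [CrossedProduct.σ, X.u_one]
  have hσσ : ∀ γ δ x, X.σ γ (X.σ δ x) = X.σ (γ * δ) x := fun γ δ x => by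
    simp only [CrossedProduct.σ]
    rw [← X.u_mul, star_mul]
    simp only [mul_assoc]
  have hσmul : ∀ γ x y, X.σ γ (x * y) = X.σ γ x * X.σ γ y := fun γ x y => by
    simp only [CrossedProduct.σ]
    have : star (X.u γ) * (X.u γ * (y * star (X.u γ))) = y * star (X.u γ) := by
      rw [← mul_assoc, huu, one_mul]
    simp only [mul_assoc, this]
  have hσinj : ∀ γ x y, X.σ γ x = X.σ γ y → x = y := fun γ x y h => by
    have := congrArg (X.σ γ⁻¹) h
    rwa [hσσ, hσσ, inv_mul_cancel, hσ1, hσ1] at this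
  have hσ0 : ∀ γ, X.σ γ 0 = 0 := fun γ => by simp [CrossedProduct.σ]
  have hσP : ∀ γ x, IsProjIn (X.A : Set (H →L[ℂ] H)) x → IsProjIn (X.A : Set (H →L[ℂ] H)) (X.σ γ x) :=
    fun γ x hx => ⟨X.conj_mem γ x hx.1, by
      simp only [CrossedProduct.σ]
      rw [star_mul, star_mul, star_star, hx.2.1, mul_assoc], by rw [← hσmul, hx.2.2]⟩
  have hσtr : ∀ γ x, x ∈ X.M → X.tr.τ (X.σ γ x) = X.tr.τ x := fun γ x hx => by
    simp only [CrossedProduct.σ]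
    rw [X.tr.tracial _ (mul_mem (X.u_mem γ) hx) _ (star_mem (X.u_mem γ)), ← mul_assoc, huu, one_mul]
  have hσne : ∀ γ, X.σ γ e ≠ 0 := fun γ h => he0 (hσinj γ _ _ (h.trans (hσ0 γ).symm))
  have hσmin : ∀ γ r, IsProjIn (X.A : Set (H →L[ℂ] H)) r → r * X.σ γ e = r → r = 0 ∨ r = X.σ γ e := by
    intro γ r hr hre
    have h1 : X.σ γ⁻¹ r * e = X.σ γ⁻¹ r := by
      have := congrArg (X.σ γ⁻¹) hre
      rwa [hσmul, hσσ, inv_mul_cancel, hσ1] at this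
    rcases hmin _ (hσP γ⁻¹ r hr) h1 with h | h
    · left; exact hσinj γ⁻¹ _ _ (h.trans (hσ0 _).symm)
    · right
      rw [← h, hσσ, mul_inv_cancel, hσ1]
  have horth : ∀ γ δ, X.σ γ e ≠ X.σ δ e → X.σ γ e * X.σ δ e = 0 := fun γ δ hne => by
    have hg := hσP γ e he
    have hd := hσP δ e he
    have hP := proj_mul hab hg hd
    have hc := hab _ hg.1 _ hd.1
    rcases hσmin δ _ hP (by rw [mul_assoc, hd.2.2]) with h | h
    · exact h
    rcases hσmin γ _ hP (by rw [hc, mul_assoc, hg.2.2]) with h' | h'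
    · exact h'
    · exact absurd (h'.symm.trans h) hne
  have hte : 0 < (X.tr.τ e).re := by
    by_contra h
    exact he0 (tr_pos_zero X.tr (X.A_sub he.1) (proj_nonneg he) (not_lt.1 h))
  set O : Set (H →L[ℂ] H) := Set.range (fun γ => X.σ γ e) with hO
  have hOorth : ∀ x ∈ O, ∀ y ∈ O, x ≠ y → x * y = 0 := by
    rintro _ ⟨γ, rfl⟩ _ ⟨δ, rfl⟩ h
    exact horth γ δ h
  have hOP : ∀ x ∈ O, IsProjIn (X.A : Set (H →L[ℂ] H)) x := by
    rintro _ ⟨γ, rfl⟩; exact hσP γ e he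
  have hsumP : ∀ F : Finset (H →L[ℂ] H), (F : Set (H →L[ℂ] H)) ⊆ O →
      IsProjIn (X.A : Set (H →L[ℂ] H)) (∑ x ∈ F, x) := by
    intro F
    induction F using Finset.induction_on with
    | empty => intro _; rw [Finset.sum_empty]; exact proj_zero
    | insert a F ha ih =>
      intro hF
      rw [Finset.coe_insert, Set.insert_subset_iff] at hF
      rw [Finset.sum_insert ha]
      refine proj_add hab (hOP a hF.1) (ih hF.2) ?_
      rw [Finset.mul_sum]
      refine Finset.sum_eq_zero fun x hx => hOorth a hF.1 x (hF.2 hx) ?_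
      rintro rfl; exact ha hx
  have hcard : ∀ F : Finset (H →L[ℂ] H), (F : Set (H →L[ℂ] H)) ⊆ O →
      (F.card : ℝ) * (X.tr.τ e).re ≤ 1 := by
    intro F hF
    have hP := hsumP F hF
    have h1 := tr_mono X.tr (X.A_sub hP.1) (one_mem X.M) (proj_le hab hP proj_one (mul_one _))
    rw [X.tr.unital, Complex.one_re, map_sum, Complex.re_sum] at h1
    rw [Finset.sum_congr rfl (g := fun _ => (X.tr.τ e).re)] at h1
    · simpa using h1
    · intro x hx
      obtain ⟨γ, rfl⟩ := hF hx
      simp only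
      rw [hσtr γ e (X.A_sub he.1)]
  have hfin : O.Finite := by
    by_contra hinf
    obtain ⟨n, hn⟩ := exists_nat_gt (1 / (X.tr.τ e).re)
    obtain ⟨F, hF, hFn⟩ := Set.Infinite.exists_subset_card_eq hinf n
    have := hcard F hF
    rw [hFn] at this
    rw [div_lt_iff₀ hte] at hn
    linarith
  set F := hfin.toFinset with hFdef
  have hFO : ∀ x, x ∈ F ↔ x ∈ O := fun x => hfin.mem_toFinset
  have hFsub : (F : Set (H →L[ℂ] H)) ⊆ O := fun x hx => (hFO x).1 hx
  have hfP := hsumP F hFsub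
  have hσO : ∀ γ x, x ∈ O → X.σ γ x ∈ O := by
    rintro γ _ ⟨δ, rfl⟩
    exact ⟨γ * δ, (hσσ γ δ e).symm⟩
  have hinv : ∀ γ, X.σ γ (∑ x ∈ F, x) = ∑ x ∈ F, x := fun γ => by
    have e1 : X.σ γ (∑ x ∈ F, x) = ∑ x ∈ F, X.σ γ x := by
      simp only [CrossedProduct.σ, Finset.mul_sum, Finset.sum_mul]
    rw [e1]
    refine Finset.sum_nbij' (X.σ γ) (X.σ γ⁻¹) ?_ ?_ ?_ ?_ ?_
    · intro x hx; exact (hFO _).2 (hσO γ x ((hFO x).1 hx))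
    · intro x hx; exact (hFO _).2 (hσO γ⁻¹ x ((hFO x).1 hx))
    · intro x _; rw [hσσ, inv_mul_cancel, hσ1]
    · intro x _; rw [hσσ, mul_inv_cancel, hσ1]
    · intro x _; rfl
  obtain ⟨c, hc⟩ := herg _ hfP.1 hinv
  have heF : e ∈ F := (hFO e).2 ⟨1, hσ1 e⟩
  have hfe : (∑ x ∈ F, x) * e = e := by
    rw [Finset.sum_mul, Finset.sum_eq_single_of_mem e heF, he.2.2]
    intro x hx hne
    exact hOorth x ((hFO x).1 hx) e ((hFO e).1 heF) hne
  have hf1 : ∑ x ∈ F, x = 1 := by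
    rw [hc, smul_mul_assoc, one_mul] at hfe
    have : (c - 1) • e = 0 := by rw [sub_smul, hfe, one_smul, sub_self]
    rcases smul_eq_zero.1 this with h | h
    · rw [hc, sub_eq_zero.1 h, one_smul]
    · exact absurd h he0
  have hsum : ∀ g : (H →L[ℂ] H) → (H →L[ℂ] H), ∑ i, g (F.equivFin.symm i : H →L[ℂ] H) = ∑ x ∈ F, g x := fun g => by
    rw [Equiv.sum_comp F.equivFin.symm (fun x : F => g x)]
    exact Finset.sum_coe_sort F g
  have hiO : ∀ i, ((F.equivFin.symm i : F) : H →L[ℂ] H) ∈ O := fun i => (hFO _).1 (F.equivFin.symm i).2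
  refine ⟨F.card, fun i => (F.equivFin.symm i : F), fun i => hOP _ (hiO i), fun i j hij => ?_, ?_, fun q hq => ?_, fun i j => ?_⟩
  · refine hOorth _ (hiO i) _ (hiO j) fun h => hij ?_
    exact F.equivFin.symm.injective (Subtype.ext h)
  · rw [hsum (fun x => x), hf1]
  · have hex : ∀ i, ∃ c : ℂ, q * ((F.equivFin.symm i : F) : H →L[ℂ] H) = c • ((F.equivFin.symm i : F) : H →L[ℂ] H) := by
      intro i
      obtain ⟨γ, hγ⟩ := hiO i
      simp only at hγ
      rw [← hγ]
      exact min_all X.tr hab X.A_sub (hσP γ e he) (hσne γ) (hσmin γ) hq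
    choose c hc using hex
    refine ⟨c, ?_⟩
    rw [← Finset.sum_congr rfl fun i _ => hc i, hsum (fun x => q * x), ← Finset.mul_sum, hf1, mul_one]
  · obtain ⟨γ, hγ⟩ := hiO i
    obtain ⟨δ, hδ⟩ := hiO j
    simp only at hγ hδ ⊢
    refine ⟨δ * γ⁻¹, ?_⟩
    rw [← hγ, ← hδ, hσσ, mul_assoc, inv_mul_cancel, mul_one]

end CDX


open CD in
/-- Lemma `finindex1`. Let `A` be an abelian von Neumann algebra with
a trace-preserving action `Γ ↷ A` such that the inclusion `L(Γ) ⊆ A ⋊ Γ` admits a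
finite Pimsner–Popa basis. Then `A` is completely atomic; moreover, if `Γ ↷ A` is
ergodic then `Γ ↷ A` is transitive. -/
theorem stmt5_finite_basis_implies_atomic
    (Γ : Type) [Group Γ] [Countable Γ]
    (H : Type) [NormedAddCommGroup H] [InnerProductSpace ℂ H] [CompleteSpace H]
    -- the crossed product `A ⋊ Γ`, with `A = X.A` abelian
    (X : CrossedProduct Γ H)
    (habel : IsAbelianSet (X.A : Set (H →L[ℂ] H)))
    -- `L(Γ) ⊆ A ⋊ Γ` admits a finite Pimsner–Popa basis `m₁, …, m_k`
    (hbasis : ∃ (k : ℕ) (m p : Fin k → (H →L[ℂ] H)),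
      (∀ i, m i ∈ X.M) ∧
      (∀ i, p i ∈ X.M ∧ star (p i) = p i ∧ p i * p i = p i) ∧
      (∀ i j, X.EL.E (m i * star (m j)) = if i = j then p i else 0) ∧
      (∀ x ∈ X.M, x = ∑ i, X.EL.E (x * star (m i)) * m i)) :
    IsCompletelyAtomic (X.A : Set (H →L[ℂ] H)) ∧
      (IsErgodic X → IsTransitiveOn X (X.A : Set (H →L[ℂ] H))) := by
  obtain ⟨k, m, _, hm, _, _, hb⟩ := hbasis
  have hat := CDX.atomic X habel m hm hb
  exact ⟨hat, fun herg => CDX.transitive X habel hat herg⟩
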